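/- arXiv:2305.06306 — 2 statements merged into one kernel-verified Lean document; each statement's English description precedes it below -/
import Mathlib

section
/- Let k ≥ 2 and s ≥ 6. For every η > 0 there exist a real δ > 0 with c_1·η ≤ δ ≤ c_2·η for constants c_1, c_2 > 0 depending only on s and k, and a constant K > 0, such that for all A ≥ 3 the number of tuples a = (a_1,…,a_s) of nonzero integers with |a| ≤ A and 0 < 𝔖_a < (log A)^{−η} is at most K·A^s/(log A)^δ. -/
open scoped BigOperators Classical
open Filter MeasureTheory

noncomputable section

/-- `e(x) = e^{2πix}`. -/
def eC (x : ℝ) : ℂ := Complex.exp (2 * Real.pi * Complex.I * x)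

/-- `W(q,r) = Σ_{h=1,…,q, (h;q)=1} e_q(r h^k)`. -/
def Wsum (k q : ℕ) (r : ℤ) : ℂ :=
  ∑ h ∈ Finset.Icc 1 q,
    if Nat.gcd h q = 1 then eC (((r * (h : ℤ) ^ k : ℤ) : ℝ) / (q : ℝ)) else 0

/-- `T_a(q) = φ(q)^{-s} Σ_{r=1,…,q, (r;q)=1} ∏_j W(q, a_j r)`. -/
def Tsum (k : ℕ) {s : ℕ} (a : Fin s → ℤ) (q : ℕ) : ℂ :=
  ((Nat.totient q : ℂ))⁻¹ ^ s *
    ∑ r ∈ Finset.Icc 1 q,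
      if Nat.gcd r q = 1 then ∏ j, Wsum k q (a j * r) else 0

/-- The singular series `𝔖_a = Σ_{q ≥ 1} T_a(q)`. -/
def singSeries (k : ℕ) {s : ℕ} (a : Fin s → ℤ) : ℂ :=
  ∑' q : ℕ, Tsum k a (q + 1)


/-- `hgt a = max_j |a_j|` as a real number. -/
def hgt {s : ℕ} (a : Fin s → ℤ) : ℝ :=
  ((Finset.univ.sup fun j => (a j).natAbs : ℕ) : ℝ)

lemma addChar_map_sum {ι A M : Type*} [AddCommMonoid A] [CommMonoid M] (ψ : AddChar A M)
    (t : Finset ι) (f : ι → A) : ψ (∑ i ∈ t, f i) = ∏ i ∈ t, ψ (f i) := by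
  induction t using Finset.cons_induction with
  | empty => simp
  | cons i t hi ih => rw [Finset.sum_cons, Finset.prod_cons, AddChar.map_add_eq_mul, ih]

lemma eC_eq_stdAddChar (q : ℕ) [NeZero q] (n : ℤ) :
    eC ((n : ℝ) / (q : ℝ)) = ZMod.stdAddChar (n : ZMod q) := by
  rw [ZMod.stdAddChar_coe, eC]
  congr 1
  push_cast
  ring

lemma sum_Icc_natCast_zmod {M : Type*} [AddCommMonoid M] (q : ℕ) [NeZero q] (G : ZMod q → M) :
    ∑ h ∈ Finset.Icc 1 q, G (h : ZMod q) = ∑ x, G x := by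
  refine Finset.sum_bij (fun h _ => (h : ZMod q)) (by simp) ?_ ?_ (by simp)
  · intro x hx y hy hxy
    rw [Finset.mem_Icc] at hx hy
    rw [ZMod.natCast_eq_natCast_iff] at hxy
    rw [Nat.modEq_iff_dvd] at hxy
    obtain ⟨c, hc⟩ := hxy
    have h1 : c < 1 := by
      by_contra! h
      nlinarith [hx.1, hx.2, hy.1, hy.2]
    have h2 : -1 < c := by
      by_contra! h
      nlinarith [hx.1, hx.2, hy.1, hy.2]
    have : c = 0 := by omega
    subst this
    omega
  · intro b _
    have hq := NeZero.pos q
    rcases Nat.eq_zero_or_pos b.val with h | h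
    · exact ⟨q, by simp; omega, by simpa using ((ZMod.val_eq_zero b).1 h).symm⟩
    · exact ⟨b.val, Finset.mem_Icc.2 ⟨h, (ZMod.val_lt b).le⟩, ZMod.natCast_zmod_val b⟩

lemma sum_Icc_coprime_eq_sum_units {M : Type*} [AddCommMonoid M] (q : ℕ) [NeZero q]
    (G : ZMod q → M) :
    ∑ h ∈ Finset.Icc 1 q, (if Nat.gcd h q = 1 then G (h : ZMod q) else 0) =
      ∑ u : (ZMod q)ˣ, G u := by
  have h1 : ∀ h : ℕ, (if Nat.gcd h q = 1 then G (h : ZMod q) else 0) =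
      (fun x : ZMod q => if IsUnit x then G x else 0) (h : ZMod q) := by
    intro h
    simp only [ZMod.isUnit_iff_coprime, Nat.Coprime]
  simp_rw [h1]
  rw [sum_Icc_natCast_zmod q (fun x : ZMod q => if IsUnit x then G x else 0), ← Finset.sum_filter]
  symm
  refine Finset.sum_bij (fun u _ => (u : ZMod q)) (by simp) ?_ ?_ (by simp)
  · intro a _ b _ h
    exact Units.ext h
  · intro b hb
    obtain ⟨u, hu⟩ := (Finset.mem_filter.1 hb).2
    exact ⟨u, Finset.mem_univ _, hu⟩

/-- The sum of `ψ(x u^k)` over the units `u` of `ℤ/qℤ`, with `ψ` the standard character. -/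
def unitPowSum (k q : ℕ) [NeZero q] (x : ZMod q) : ℂ :=
  ∑ u : (ZMod q)ˣ, ZMod.stdAddChar (x * (u : ZMod q) ^ k)

lemma Wsum_eq_unitPowSum (k q : ℕ) [NeZero q] (r : ℤ) :
    Wsum k q r = unitPowSum k q (r : ZMod q) := by
  unfold unitPowSum
  rw [← sum_Icc_coprime_eq_sum_units q
    (fun x : ZMod q => (ZMod.stdAddChar ((r : ZMod q) * x ^ k) : ℂ)), Wsum]
  refine Finset.sum_congr rfl fun h _ => ?_
  rw [eC_eq_stdAddChar]
  push_cast
  rfl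

lemma Tsum_eq_sum_units (k q : ℕ) [NeZero q] {s : ℕ} (a : Fin s → ℤ) :
    Tsum k a q = ((Nat.totient q : ℂ))⁻¹ ^ s *
      ∑ v : (ZMod q)ˣ, ∏ j, unitPowSum k q ((a j : ZMod q) * v) := by
  rw [← sum_Icc_coprime_eq_sum_units q
    (fun x : ZMod q => ∏ j, unitPowSum k q ((a j : ZMod q) * x)), Tsum]
  congr 1
  refine Finset.sum_congr rfl fun h _ => ?_
  simp_rw [Wsum_eq_unitPowSum]
  push_cast
  rfl

lemma sum_comp_monoidHom_of_surjective {G H M : Type*} [Group G] [Fintype G] [Group H] [Fintype H]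
    [CommSemiring M] (f : G →* H) (hf : Function.Surjective f) (g : H → M) :
    ∑ x, g (f x) = (Nat.card f.ker : M) * ∑ y, g y := by
  rw [← Finset.sum_fiberwise_of_maps_to (t := Finset.univ) (g := f) (by simp), Finset.mul_sum]
  refine Finset.sum_congr rfl fun y _ => ?_
  rw [Finset.sum_congr rfl (g := fun _ => g y)
    (fun x hx => by rw [(Finset.mem_filter.1 hx).2]), Finset.sum_const, nsmul_eq_mul]
  congr 2
  rw [MonoidHom.card_fiber_eq_of_mem_range f (hf y) ⟨1, map_one f⟩, Nat.card_eq_fintype_card,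
    Fintype.card_subtype]
  congr 1
  ext
  simp [MonoidHom.mem_ker]

lemma card_unitsMap_ker {d q : ℕ} [NeZero d] [NeZero q] (h : d ∣ q) :
    (Nat.card (ZMod.unitsMap h).ker : ℂ) = (Nat.totient q : ℂ) / Nat.totient d := by
  have h1 := sum_comp_monoidHom_of_surjective (ZMod.unitsMap h) (ZMod.unitsMap_surjective h)
    (fun _ => (1 : ℂ))
  have h2 : (Nat.totient d : ℂ) ≠ 0 := by
    exact_mod_cast (Nat.totient_pos.2 (NeZero.pos d)).ne'
  simp only [Finset.sum_const, Finset.card_univ, ZMod.card_units_eq_totient, nsmul_eq_mul,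
    mul_one] at h1
  rw [h1, mul_div_cancel_right₀ _ h2]

lemma Wsum_mul_mul (k : ℕ) {e d : ℕ} (he : 0 < e) (hd : 0 < d) (r : ℤ) :
    Wsum k (e * d) (e * r) = (Nat.totient (e * d) : ℂ) / Nat.totient d * Wsum k d r := by
  have : NeZero d := ⟨hd.ne'⟩
  have : NeZero (e * d) := ⟨(Nat.mul_pos he hd).ne'⟩
  have hdv : d ∣ e * d := Dvd.intro_left e rfl
  rw [Wsum_eq_unitPowSum, Wsum_eq_unitPowSum, unitPowSum, unitPowSum, ← card_unitsMap_ker hdv,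
    ← sum_comp_monoidHom_of_surjective (ZMod.unitsMap hdv) (ZMod.unitsMap_surjective hdv)
      (fun u : (ZMod d)ˣ => (ZMod.stdAddChar ((r : ZMod d) * (u : ZMod d) ^ k) : ℂ))]
  refine Finset.sum_congr rfl fun u _ => ?_
  have hu : (u : ZMod (e * d)) = (((u : ZMod (e * d)).val : ℤ) : ZMod (e * d)) := by simp
  have hu' : ((ZMod.unitsMap hdv u : (ZMod d)ˣ) : ZMod d) =
      (((u : ZMod (e * d)).val : ℤ) : ZMod d) := by
    rw [ZMod.unitsMap_val, ZMod.cast_eq_val]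
    simp
  rw [hu']
  generalize ((u : ZMod (e * d)).val : ℤ) = n at hu
  rw [hu]
  have h1 : (((e * r : ℤ) : ZMod (e * d)) * (n : ZMod (e * d)) ^ k) =
      ((e * r * n ^ k : ℤ) : ZMod (e * d)) := by push_cast; rfl
  have h2 : ((r : ZMod d) * (n : ZMod d) ^ k) = ((r * n ^ k : ℤ) : ZMod d) := by push_cast; rfl
  rw [h1, h2, ← eC_eq_stdAddChar, ← eC_eq_stdAddChar]
  congr 1
  have : (e : ℝ) ≠ 0 := by exact_mod_cast he.ne'
  have : (d : ℝ) ≠ 0 := by exact_mod_cast hd.ne'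
  push_cast
  field_simp

lemma sum_Icc_eq_sum_divisors {M : Type*} [AddCommMonoid M] (q : ℕ) (hq : 0 < q) (g : ℕ → M) :
    ∑ r ∈ Finset.Icc 1 q, g r =
      ∑ d ∈ q.divisors, ∑ r ∈ Finset.Icc 1 d, if Nat.gcd r d = 1 then g (q / d * r) else 0 := by
  rw [← Finset.sum_fiberwise_of_maps_to (t := q.divisors) (g := fun r => q / Nat.gcd r q)
    (fun r _ => Nat.mem_divisors.2 ⟨Nat.div_dvd_of_dvd (Nat.gcd_dvd_right r q), hq.ne'⟩)]
  refine Finset.sum_congr rfl fun d hd => ?_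
  obtain ⟨e, rfl⟩ := (Nat.mem_divisors.1 hd).1
  have hd0 : 0 < d := Nat.pos_of_mul_pos_right hq
  have he0 : 0 < e := Nat.pos_of_mul_pos_left hq
  rw [← Finset.sum_filter, Nat.mul_div_cancel_left _ hd0]
  symm
  refine Finset.sum_bij (fun r _ => e * r) ?_ ?_ ?_ (by simp)
  · intro r hr
    simp only [Finset.mem_filter, Finset.mem_Icc] at hr ⊢
    refine ⟨⟨Nat.mul_pos he0 hr.1.1, ?_⟩, ?_⟩
    · rw [mul_comm d]
      exact Nat.mul_le_mul_left _ hr.1.2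
    · rw [mul_comm d, Nat.gcd_mul_left, hr.2, mul_one, Nat.mul_div_cancel_left _ he0]
  · intro x _ y _ h
    exact Nat.eq_of_mul_eq_mul_left he0 h
  · intro b hb
    simp only [Finset.mem_filter, Finset.mem_Icc] at hb
    have hg : Nat.gcd b (d * e) = e := by
      have h1 := Nat.div_mul_cancel (Nat.gcd_dvd_right b (d * e))
      rw [hb.2] at h1
      exact Nat.eq_of_mul_eq_mul_left hd0 h1
    obtain ⟨c, rfl⟩ : e ∣ b := hg ▸ Nat.gcd_dvd_left b (d * e)
    refine ⟨c, ?_, rfl⟩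
    rw [mul_comm d, Nat.gcd_mul_left] at hg
    simp only [Finset.mem_filter, Finset.mem_Icc]
    refine ⟨⟨Nat.pos_of_mul_pos_left hb.1.1, ?_⟩, ?_⟩
    · have := hb.1.2
      rw [mul_comm d] at this
      exact Nat.le_of_mul_le_mul_left this he0
    · exact Nat.eq_of_mul_eq_mul_left he0 (by rw [hg, mul_one])

/-- The unit solutions of `a_1 h_1^k + ⋯ + a_s h_s^k = 0` modulo `q`. -/
def unitSolutions (k q : ℕ) {s : ℕ} (a : Fin s → ℤ) : Set (Fin s → (ZMod q)ˣ) :=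
  {h | ∑ j, (a j : ZMod q) * (h j : ZMod q) ^ k = 0}

lemma sum_prod_unitPowSum (k q : ℕ) [NeZero q] {s : ℕ} (a : Fin s → ℤ) :
    ∑ x : ZMod q, ∏ j, unitPowSum k q ((a j : ZMod q) * x) =
      q * ((unitSolutions k q a).ncard : ℂ) := by
  have h1 : ∀ x : ZMod q, ∏ j, unitPowSum k q ((a j : ZMod q) * x) =
      ∑ h : Fin s → (ZMod q)ˣ,
        ZMod.stdAddChar (x * ∑ j, (a j : ZMod q) * (h j : ZMod q) ^ k) := by
    intro x
    unfold unitPowSum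
    rw [Finset.prod_univ_sum, Fintype.piFinset_univ]
    refine Finset.sum_congr rfl fun h _ => ?_
    rw [Finset.mul_sum, addChar_map_sum]
    refine Finset.prod_congr rfl fun j _ => ?_
    congr 1
    ring
  simp_rw [h1]
  rw [Finset.sum_comm]
  have h2 : (unitSolutions k q a) = (Finset.univ.filter fun h : Fin s → (ZMod q)ˣ =>
    ∑ j, (a j : ZMod q) * (h j : ZMod q) ^ k = 0 : Finset _) := by
    ext; simp [unitSolutions]
  rw [h2, Set.ncard_coe_finset]
  simp_rw [AddChar.sum_mulShift _ (ZMod.isPrimitive_stdAddChar q), ZMod.card]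
  push_cast
  rw [← Finset.sum_filter, Finset.sum_const, nsmul_eq_mul, mul_comm]

lemma sum_divisors_Tsum (k q : ℕ) [NeZero q] {s : ℕ} (a : Fin s → ℤ) :
    ∑ d ∈ q.divisors, Tsum k a d =
      ((Nat.totient q : ℂ))⁻¹ ^ s * (q * ((unitSolutions k q a).ncard : ℂ)) := by
  have hq := NeZero.pos q
  have hφ : (Nat.totient q : ℂ) ≠ 0 := by exact_mod_cast (Nat.totient_pos.2 hq).ne'
  rw [← sum_prod_unitPowSum, ← sum_Icc_natCast_zmod q
    (fun x => ∏ j, unitPowSum k q ((a j : ZMod q) * x)), sum_Icc_eq_sum_divisors q hq,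
    Finset.mul_sum]
  refine Finset.sum_congr rfl fun d hd => ?_
  obtain ⟨e, rfl⟩ := (Nat.mem_divisors.1 hd).1
  have hd0 : 0 < d := Nat.pos_of_mul_pos_right hq
  have he0 : 0 < e := Nat.pos_of_mul_pos_left hq
  have hφd : (Nat.totient d : ℂ) ≠ 0 := by exact_mod_cast (Nat.totient_pos.2 hd0).ne'
  rw [Nat.mul_div_cancel_left _ hd0, Tsum, Finset.mul_sum, Finset.mul_sum]
  refine Finset.sum_congr rfl fun r _ => ?_
  split_ifs with h
  · have h3 : ∀ j, unitPowSum k (d * e) ((a j : ZMod (d * e)) * ((e * r : ℕ) : ZMod (d * e))) =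
        (Nat.totient (d * e) : ℂ) / Nat.totient d * Wsum k d (a j * r) := by
      intro j
      have := Wsum_mul_mul k he0 hd0 (a j * r)
      rw [mul_comm e d, Wsum_eq_unitPowSum] at this
      rw [← this]
      congr 1
      push_cast
      ring
    simp_rw [h3]
    rw [Finset.prod_mul_distrib, Finset.prod_const, Finset.card_univ, Fintype.card_fin,
      ← mul_assoc, ← mul_pow]
    congr 2
    field_simp
  · simp

lemma ncard_unitSolutions_mul (k : ℕ) {s : ℕ} (a : Fin s → ℤ) {m n : ℕ} (h : m.Coprime n) :
    (unitSolutions k (m * n) a).ncard = (unitSolutions k m a).ncard * (unitSolutions k n a).ncard := by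
  let E : (ZMod (m * n))ˣ ≃* (ZMod m)ˣ × (ZMod n)ˣ :=
    (Units.mapEquiv (ZMod.chineseRemainder h).toMulEquiv).trans MulEquiv.prodUnits
  let F : (Fin s → (ZMod (m * n))ˣ) ≃ (Fin s → (ZMod m)ˣ) × (Fin s → (ZMod n)ˣ) :=
    (Equiv.arrowCongr (Equiv.refl _) E.toEquiv).trans
      (Equiv.arrowProdEquivProdArrow _ (fun _ => (ZMod m)ˣ) (fun _ => (ZMod n)ˣ))
  have hE : ∀ u : (ZMod (m * n))ˣ, ZMod.chineseRemainder h (u : ZMod (m * n)) =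
      (((E u).1 : ZMod m), ((E u).2 : ZMod n)) := fun u => rfl
  rw [← Set.ncard_prod, ← Set.ncard_image_of_injective _ F.injective]
  congr 1
  ext x
  obtain ⟨y, rfl⟩ := F.surjective x
  rw [Function.Injective.mem_set_image F.injective]
  have hF : ∀ j, (F y).1 j = (E (y j)).1 ∧ (F y).2 j = (E (y j)).2 := fun j => ⟨rfl, rfl⟩
  rw [Set.mem_prod]
  simp only [unitSolutions, Set.mem_ofPred_eq, (hF _).1, (hF _).2]
  rw [← (ZMod.chineseRemainder h).injective.eq_iff, map_sum, map_zero]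
  simp_rw [map_mul, map_pow, hE, map_intCast]
  rw [Prod.ext_iff, Prod.fst_sum, Prod.snd_sum]
  rfl

lemma Tsum_zero (k : ℕ) {s : ℕ} (a : Fin s → ℤ) : Tsum k a 0 = 0 := by
  simp [Tsum]

lemma Tsum_one (k : ℕ) {s : ℕ} (a : Fin s → ℤ) : Tsum k a 1 = 1 := by
  have h : ∀ n : ℤ, Complex.exp (2 * Real.pi * Complex.I * n) = 1 := fun n => by
    rw [mul_comm, Complex.exp_int_mul_two_pi_mul_I]
  simp [Tsum, Wsum, eC, h]

/-- The normalised number of unit solutions modulo `q`, as an arithmetic function. -/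
def unitSolutionDensity (k : ℕ) {s : ℕ} (a : Fin s → ℤ) : ArithmeticFunction ℂ :=
  ⟨fun q => ((Nat.totient q : ℂ))⁻¹ ^ s * (q * ((unitSolutions k q a).ncard : ℂ)), by simp⟩

/-- `Tsum` as an arithmetic function. -/
def TsumArith (k : ℕ) {s : ℕ} (a : Fin s → ℤ) : ArithmeticFunction ℂ :=
  ⟨Tsum k a, Tsum_zero k a⟩

lemma TsumArith_mul_zeta (k : ℕ) {s : ℕ} (a : Fin s → ℤ) :
    TsumArith k a * ArithmeticFunction.zeta = unitSolutionDensity k a := by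
  ext q
  rcases Nat.eq_zero_or_pos q with rfl | hq
  · simp
  have : NeZero q := ⟨hq.ne'⟩
  rw [ArithmeticFunction.coe_mul_zeta_apply]
  exact sum_divisors_Tsum k q a

lemma unitSolutionDensity_isMultiplicative (k : ℕ) {s : ℕ} (a : Fin s → ℤ) :
    (unitSolutionDensity k a).IsMultiplicative := by
  constructor
  · have := sum_divisors_Tsum k 1 a
    rw [Nat.divisors_one, Finset.sum_singleton, Tsum_one] at this
    exact this.symm
  · intro m n h
    simp only [unitSolutionDensity, ArithmeticFunction.coe_mk]
    rw [ncard_unitSolutions_mul k a h, Nat.totient_mul h]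
    push_cast
    rw [mul_inv, mul_pow]
    ring

lemma Tsum_mul (k : ℕ) {s : ℕ} (a : Fin s → ℤ) {m n : ℕ} (h : m.Coprime n) :
    Tsum k a (m * n) = Tsum k a m * Tsum k a n := by
  have h1 : TsumArith k a = unitSolutionDensity k a * (ArithmeticFunction.moebius : ArithmeticFunction ℂ) := by
    rw [← TsumArith_mul_zeta, mul_assoc, ArithmeticFunction.coe_zeta_mul_coe_moebius, mul_one]
  have h2 : (TsumArith k a).IsMultiplicative := by
    rw [h1]
    exact (unitSolutionDensity_isMultiplicative k a).mul
      ArithmeticFunction.isMultiplicative_moebius.intCast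
  exact h2.map_mul_of_coprime h

lemma unitPowSum_eq_zero {p : ℕ} (hp : p.Prime) {k v m l k' : ℕ} {b' : ℤ} [NeZero (p ^ l)]
    (hk : k = p ^ v * k') (hk' : ¬ p ∣ k') (hb' : ¬ (p : ℤ) ∣ b') (hl : m + 2 * v + 2 ≤ l) :
    unitPowSum k (p ^ l) ((p ^ m * b' : ℤ) : ZMod (p ^ l)) = 0 := by
  obtain ⟨t, ht⟩ : ∃ t, l = m + v + 1 + t := ⟨l - (m + v + 1), by omega⟩
  have hpl : (p : ZMod (p ^ l)) ^ l = 0 := by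
    rw [← Nat.cast_pow, ZMod.natCast_self]
  have hp0 : (p : ℂ) ≠ 0 := by exact_mod_cast hp.ne_zero
  have hcop : ∀ i : ℕ, Nat.Coprime (1 + i * p ^ t) (p ^ l) := by
    intro i
    apply Nat.Coprime.pow_right
    rw [Nat.coprime_comm, hp.coprime_iff_not_dvd]
    intro h
    have h2 : p ∣ i * p ^ t := Dvd.dvd.mul_left (dvd_pow_self p (by omega)) i
    exact hp.one_lt.ne' (Nat.dvd_one.1 ((Nat.dvd_add_left h2).1 h))
  have key : ∀ i : ℕ, ((p ^ m * b' : ℤ) : ZMod (p ^ l)) * ((1 + i * p ^ t : ℕ) : ZMod (p ^ l)) ^ k =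
      ((p ^ m * b' : ℤ) : ZMod (p ^ l)) + i * ((p ^ (l - 1) * (b' * k') : ℤ) : ZMod (p ^ l)) := by
    intro i
    have hz := (Polynomial.powAddExpansion (1 : ZMod (p ^ l)) (i * p ^ t) k).2
    generalize (Polynomial.powAddExpansion (1 : ZMod (p ^ l)) (i * p ^ t) k).1 = z at hz
    have h2 : (p : ZMod (p ^ l)) ^ (m + 2 * t) = 0 := by
      rw [show m + 2 * t = l + (m + 2 * t - l) by omega, pow_add, hpl, zero_mul]
    have h3 : (p : ZMod (p ^ l)) ^ (l - 1) = p ^ m * p ^ v * p ^ t := by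
      rw [← pow_add, ← pow_add]
      congr 1
      omega
    push_cast
    rw [hz, h3]
    have h4 : (k : ZMod (p ^ l)) = p ^ v * k' := by rw [hk]; push_cast; rfl
    rw [one_pow, one_pow, h4]
    have h5 : (p : ZMod (p ^ l)) ^ m * (p ^ t) ^ 2 = 0 := by
      rw [← h2]; ring
    linear_combination (b' * z * i ^ 2) * h5
  set c : ZMod (p ^ l) := ((p ^ (l - 1) * (b' * k') : ℤ) : ZMod (p ^ l)) with hc
  set B : ZMod (p ^ l) := ((p ^ m * b' : ℤ) : ZMod (p ^ l)) with hB
  have hc0 : c ≠ 0 := by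
    rw [hc, Ne, ZMod.intCast_zmod_eq_zero_iff_dvd]
    intro h
    have h1 : ((p ^ l : ℕ) : ℤ) = p ^ (l - 1) * p := by
      rw [← pow_succ, show l - 1 + 1 = l by omega]; push_cast; rfl
    rw [h1] at h
    have h2 := Int.dvd_of_mul_dvd_mul_left (by exact_mod_cast pow_ne_zero _ hp.ne_zero) h
    rcases (Nat.prime_iff_prime_int.1 hp).dvd_or_dvd h2 with h3 | h3
    · exact hb' h3
    · exact hk' (by exact_mod_cast h3)
  have hpc : (p : ZMod (p ^ l)) * c = 0 := by
    rw [hc]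
    push_cast
    rw [← mul_assoc, ← pow_succ', show l - 1 + 1 = l by omega, hpl, zero_mul]
  have hshift : ∀ i : ℕ, unitPowSum k (p ^ l) B = ∑ u : (ZMod (p ^ l))ˣ,
      ZMod.stdAddChar (B * (u : ZMod (p ^ l)) ^ k) *
        ZMod.stdAddChar (c * (u : ZMod (p ^ l)) ^ k) ^ i := by
    intro i
    rw [unitPowSum, ← Equiv.sum_comp (Equiv.mulLeft (ZMod.unitOfCoprime _ (hcop i)))]
    refine Finset.sum_congr rfl fun u _ => ?_
    rw [← AddChar.map_nsmul_eq_pow, ← AddChar.map_add_eq_mul]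
    congr 1
    rw [Equiv.coe_mulLeft, Units.val_mul, ZMod.coe_unitOfCoprime, mul_pow, ← mul_assoc, key,
      nsmul_eq_mul]
    ring
  have hsum : (p : ℂ) * unitPowSum k (p ^ l) B = 0 := by
    have h1 : (p : ℂ) * unitPowSum k (p ^ l) B =
        ∑ i ∈ Finset.range p, unitPowSum k (p ^ l) B := by simp
    rw [h1, Finset.sum_congr rfl fun i _ => hshift i, Finset.sum_comm]
    refine Finset.sum_eq_zero fun u _ => ?_
    rw [← Finset.mul_sum]
    apply mul_eq_zero_of_right
    have hne : (ZMod.stdAddChar (c * (u : ZMod (p ^ l)) ^ k) : ℂ) ≠ 1 := by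
      rw [← AddChar.map_zero_eq_one (ZMod.stdAddChar (N := p ^ l)), ZMod.injective_stdAddChar.ne_iff]
      intro h
      exact hc0 (((u ^ k).isUnit.mul_left_eq_zero).1 (by simpa using h))
    have h2 := geom_sum_mul (ZMod.stdAddChar (c * (u : ZMod (p ^ l)) ^ k) : ℂ) p
    rw [← AddChar.map_nsmul_eq_pow, nsmul_eq_mul, ← mul_assoc, hpc, zero_mul,
      AddChar.map_zero_eq_one, sub_self] at h2
    exact (mul_eq_zero.1 h2).resolve_right (sub_ne_zero.2 hne)
  exact (mul_eq_zero.1 hsum).resolve_left hp0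

lemma Tsum_prime_pow_eq_zero {p : ℕ} (hp : p.Prime) {k v m l k' s : ℕ} {a : Fin s → ℤ}
    (hk : k = p ^ v * k') (hk' : ¬ p ∣ k') (j : Fin s) {b' : ℤ} (hj : a j = p ^ m * b')
    (hb' : ¬ (p : ℤ) ∣ b') (hl : m + 2 * v + 2 ≤ l) : Tsum k a (p ^ l) = 0 := by
  have : NeZero (p ^ l) := ⟨pow_ne_zero _ hp.ne_zero⟩
  rw [Tsum_eq_sum_units]
  apply mul_eq_zero_of_right
  refine Finset.sum_eq_zero fun u _ => Finset.prod_eq_zero (Finset.mem_univ j) ?_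
  have hu : (u : ZMod (p ^ l)) = ((u : ZMod (p ^ l)).val : ℤ) := by simp
  have hcop : Nat.Coprime (u : ZMod (p ^ l)).val (p ^ l) := ZMod.val_coe_unit_coprime u
  have hd : ¬ (p : ℤ) ∣ b' * ((u : ZMod (p ^ l)).val : ℤ) := by
    intro h
    rcases (Nat.prime_iff_prime_int.1 hp).dvd_or_dvd h with h3 | h3
    · exact hb' h3
    · have h4 : p ∣ (u : ZMod (p ^ l)).val := by exact_mod_cast h3
      exact hp.one_lt.ne' (Nat.dvd_one.1 (hcop ▸ Nat.dvd_gcd h4 (dvd_pow_self p (by omega))))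
  rw [hj, hu, ← Int.cast_mul, mul_assoc]
  exact unitPowSum_eq_zero hp hk hk' hd hl

lemma tsum_Tsum_prime_pow {p : ℕ} (hp : p.Prime) {k v m k' s : ℕ} {a : Fin s → ℤ}
    (hk : k = p ^ v * k') (hk' : ¬ p ∣ k') (j : Fin s) {b' : ℤ} (hj : a j = p ^ m * b')
    (hb' : ¬ (p : ℤ) ∣ b') :
    ∑' e, Tsum k a (p ^ e) = ∑ e ∈ Finset.range (m + 2 * v + 2), Tsum k a (p ^ e) := by
  apply tsum_eq_sum
  intro e he
  exact Tsum_prime_pow_eq_zero hp hk hk' j hj hb' (by simpa using he)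

lemma exists_tsum_Tsum_prime_pow_eq {p : ℕ} (hp : p.Prime) {k v m k' s : ℕ} {a : Fin s → ℤ}
    (hk : k = p ^ v * k') (hk' : ¬ p ∣ k') (j : Fin s) {b' : ℤ} (hj : a j = p ^ m * b')
    (hb' : ¬ (p : ℤ) ∣ b') :
    ∃ x : ℝ, ∑' e, Tsum k a (p ^ e) = x ∧ (x ≠ 0 → (((p : ℝ) ^ (m + 2 * v + 1)) ^ s)⁻¹ ≤ x) := by
  set L := m + 2 * v + 1 with hL
  have : NeZero (p ^ L) := ⟨pow_ne_zero _ hp.ne_zero⟩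
  rw [tsum_Tsum_prime_pow hp hk hk' j hj hb', show m + 2 * v + 2 = L + 1 by omega,
    ← Nat.sum_divisors_prime_pow hp, sum_divisors_Tsum]
  refine ⟨((Nat.totient (p ^ L) : ℝ))⁻¹ ^ s * ((p ^ L : ℕ) * ((unitSolutions k (p ^ L) a).ncard : ℝ)),
    by push_cast; rfl, fun hx => ?_⟩
  have h1 : 1 ≤ (unitSolutions k (p ^ L) a).ncard := by
    rw [Nat.one_le_iff_ne_zero]
    intro h
    simp [h] at hx
  have h1' : (1 : ℝ) ≤ ((unitSolutions k (p ^ L) a).ncard : ℝ) := by exact_mod_cast h1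
  have hpos : 0 < p ^ L := pow_pos hp.pos _
  have h2 : (1 : ℝ) ≤ ((p ^ L : ℕ) : ℝ) := by exact_mod_cast hpos
  have h3 : (0 : ℝ) < Nat.totient (p ^ L) := by exact_mod_cast Nat.totient_pos.2 hpos
  have h4 : (Nat.totient (p ^ L) : ℝ) ≤ (p : ℝ) ^ L := by exact_mod_cast Nat.totient_le (p ^ L)
  calc (((p : ℝ) ^ L) ^ s)⁻¹ ≤ ((Nat.totient (p ^ L) : ℝ) ^ s)⁻¹ := by gcongr
    _ = ((Nat.totient (p ^ L) : ℝ))⁻¹ ^ s * (1 * 1) := by rw [inv_pow]; ring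
    _ ≤ _ := by gcongr

lemma card_units_pow_eq_le (p : ℕ) [Fact p.Prime] {k : ℕ} (hk : 0 < k) (y : ZMod p) :
    (Finset.univ.filter fun u : (ZMod p)ˣ => (u : ZMod p) ^ k = y).card ≤ k := by
  refine le_trans ?_ (Polynomial.card_nthRoots k y)
  refine le_trans ?_ (Multiset.toFinset_card_le _)
  refine Finset.card_le_card_of_injOn (fun u => (u : ZMod p)) ?_ (fun _ _ _ _ h => Units.ext h)
  intro u hu
  simpa [Polynomial.mem_nthRoots hk] using hu

lemma norm_unitPowSum_le_card (k q : ℕ) [NeZero q] (x : ZMod q) :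
    ‖unitPowSum k q x‖ ≤ Nat.totient q := by
  refine (norm_sum_le _ _).trans ?_
  simp [ZMod.card_units_eq_totient]

lemma sum_norm_sq_unitPowSum_le (p : ℕ) [Fact p.Prime] {k : ℕ} (hk : 0 < k) :
    ∑ x : ZMod p, ‖unitPowSum k p x‖ ^ 2 ≤ p * ((p - 1 : ℕ) * k) := by
  have h1 : ∀ x : ZMod p, ((‖unitPowSum k p x‖ ^ 2 : ℝ) : ℂ) = ∑ u : (ZMod p)ˣ, ∑ w : (ZMod p)ˣ,
      ZMod.stdAddChar (x * ((u : ZMod p) ^ k - (w : ZMod p) ^ k)) := by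
    intro x
    rw [Complex.ofReal_pow, ← Complex.mul_conj', unitPowSum, map_sum, Finset.sum_mul_sum]
    refine Finset.sum_congr rfl fun u _ => Finset.sum_congr rfl fun w _ => ?_
    rw [← AddChar.map_neg_eq_conj, ← AddChar.map_add_eq_mul]
    congr 1
    ring
  have h2 : ((∑ x : ZMod p, ‖unitPowSum k p x‖ ^ 2 : ℝ) : ℂ) =
      ((∑ w : (ZMod p)ˣ, (p : ℝ) *
        (Finset.univ.filter fun u : (ZMod p)ˣ => (u : ZMod p) ^ k = (w : ZMod p) ^ k).card : ℝ) : ℂ) := by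
    rw [Complex.ofReal_sum]
    rw [Finset.sum_congr rfl fun x _ => h1 x, Finset.sum_comm,
      Finset.sum_congr rfl fun u _ => Finset.sum_comm, Finset.sum_comm, Complex.ofReal_sum]
    refine Finset.sum_congr rfl fun w _ => ?_
    rw [Finset.sum_congr rfl fun u _ =>
      AddChar.sum_mulShift _ (ZMod.isPrimitive_stdAddChar p)]
    simp_rw [ZMod.card, sub_eq_zero]
    push_cast
    rw [← Finset.sum_filter, Finset.sum_const, nsmul_eq_mul, mul_comm]
  rw [Complex.ofReal_inj.1 h2]
  calc _ ≤ ∑ w : (ZMod p)ˣ, (p : ℝ) * k := by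
        refine Finset.sum_le_sum fun w _ => ?_
        gcongr
        exact card_units_pow_eq_le p hk _
    _ = _ := by
        rw [Finset.sum_const, Finset.card_univ, ZMod.card_units, nsmul_eq_mul]
        ring

lemma norm_unitPowSum_le (p : ℕ) [Fact p.Prime] {k : ℕ} (hk : 0 < k) {x : ZMod p} (hx : x ≠ 0) :
    ‖unitPowSum k p x‖ ≤ k * Real.sqrt p := by
  have hp : 1 < p := (Fact.out : p.Prime).one_lt
  have h1 : ∀ m : (ZMod p)ˣ, unitPowSum k p (x * (m : ZMod p) ^ k) = unitPowSum k p x := by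
    intro m
    conv_rhs => rw [unitPowSum, ← Equiv.sum_comp (Equiv.mulLeft m)]
    rw [unitPowSum]
    refine Finset.sum_congr rfl fun u _ => ?_
    rw [Equiv.coe_mulLeft, Units.val_mul, mul_pow, mul_assoc]
  have h2 : ((p - 1 : ℕ) : ℝ) * ‖unitPowSum k p x‖ ^ 2 ≤
      ∑ y : ZMod p, (k : ℝ) * ‖unitPowSum k p y‖ ^ 2 := by
    calc ((p - 1 : ℕ) : ℝ) * ‖unitPowSum k p x‖ ^ 2
        = ∑ m : (ZMod p)ˣ, ‖unitPowSum k p (x * (m : ZMod p) ^ k)‖ ^ 2 := by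
          simp_rw [h1]
          rw [Finset.sum_const, Finset.card_univ, ZMod.card_units, nsmul_eq_mul]
      _ = ∑ y : ZMod p, ∑ m ∈ Finset.univ.filter fun m : (ZMod p)ˣ => x * (m : ZMod p) ^ k = y,
            ‖unitPowSum k p (x * (m : ZMod p) ^ k)‖ ^ 2 :=
          (Finset.sum_fiberwise_of_maps_to (by simp) _).symm
      _ ≤ _ := by
          refine Finset.sum_le_sum fun y _ => ?_
          rw [Finset.sum_congr rfl (g := fun _ => ‖unitPowSum k p y‖ ^ 2)
            (fun m hm => by rw [(Finset.mem_filter.1 hm).2]), Finset.sum_const, nsmul_eq_mul]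
          gcongr
          refine le_trans (Finset.card_le_card ?_) (card_units_pow_eq_le p hk (x⁻¹ * y))
          intro m hm
          simp only [Finset.mem_filter, Finset.mem_univ, true_and] at hm ⊢
          rw [← hm, ← mul_assoc, inv_mul_cancel₀ hx, one_mul]
  rw [← Finset.mul_sum] at h2
  have h3 := h2.trans (mul_le_mul_of_nonneg_left (sum_norm_sq_unitPowSum_le p hk) (by positivity))
  have hp' : (0 : ℝ) < ((p - 1 : ℕ) : ℝ) := by exact_mod_cast Nat.sub_pos_of_lt hp
  have h4 : ‖unitPowSum k p x‖ ^ 2 ≤ (k * Real.sqrt p) ^ 2 := by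
    rw [mul_pow, Real.sq_sqrt (by positivity)]
    refine le_of_mul_le_mul_left (h3.trans (le_of_eq ?_)) hp'
    ring
  exact (sq_le_sq₀ (norm_nonneg _) (by positivity)).1 h4

lemma norm_Tsum_prime_le {p : ℕ} (hp : p.Prime) {k s : ℕ} (hk : 0 < k) (hs : 6 ≤ s)
    {a : Fin s → ℤ} (j₀ : Fin s) (ha : ∀ j, j ≠ j₀ → ¬ (p : ℤ) ∣ a j) :
    ‖Tsum k a p‖ ≤ (2 * k) ^ s * (1 / Real.sqrt p ^ 3) := by
  have : Fact p.Prime := ⟨hp⟩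
  have hp1 : (2 : ℝ) ≤ p := by exact_mod_cast hp.two_le
  have hk1 : (1 : ℝ) ≤ k := by exact_mod_cast hk
  have hφ : ((Nat.totient p : ℕ) : ℝ) = p - 1 := by
    rw [Nat.totient_prime hp, Nat.cast_sub hp.one_lt.le, Nat.cast_one]
  have hsq : (1 : ℝ) ≤ Real.sqrt p := by
    rw [Real.one_le_sqrt]; linarith
  have hsq2 : Real.sqrt p ^ 2 = p := Real.sq_sqrt (by positivity)
  obtain ⟨n, rfl⟩ : ∃ n, s = n + 1 := ⟨s - 1, by omega⟩
  have h1 : ∀ v : (ZMod p)ˣ, ‖∏ j, unitPowSum k p ((a j : ZMod p) * v)‖ ≤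
      (p - 1) * (k * Real.sqrt p) ^ n := by
    intro v
    rw [norm_prod, ← Finset.mul_prod_erase _ _ (Finset.mem_univ j₀)]
    refine mul_le_mul ?_ ?_ (Finset.prod_nonneg fun _ _ => norm_nonneg _) (by linarith)
    · exact (norm_unitPowSum_le_card _ _ _).trans hφ.le
    · calc _ ≤ ∏ j ∈ Finset.univ.erase j₀, (k * Real.sqrt p) := by
            refine Finset.prod_le_prod (fun _ _ => norm_nonneg _) fun j hj => ?_
            apply norm_unitPowSum_le p hk
            refine mul_ne_zero ?_ v.ne_zero
            rw [Ne, ZMod.intCast_zmod_eq_zero_iff_dvd]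
            exact ha j (Finset.ne_of_mem_erase hj)
        _ = _ := by
            rw [Finset.prod_const, Finset.card_erase_of_mem (Finset.mem_univ _), Finset.card_univ,
              Fintype.card_fin, Nat.add_sub_cancel]
  have h2 : ‖∑ v : (ZMod p)ˣ, ∏ j, unitPowSum k p ((a j : ZMod p) * v)‖ ≤
      (p - 1) * ((p - 1) * (k * Real.sqrt p) ^ n) := by
    refine (norm_sum_le_of_le _ fun v _ => h1 v).trans (le_of_eq ?_)
    rw [Finset.sum_const, Finset.card_univ, ZMod.card_units_eq_totient, nsmul_eq_mul, hφ]
  rw [Tsum_eq_sum_units, norm_mul, norm_pow, norm_inv, Complex.norm_natCast, hφ]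
  have hpm : (0 : ℝ) < p - 1 := by linarith
  calc ((p : ℝ) - 1)⁻¹ ^ (n + 1) * ‖∑ v : (ZMod p)ˣ, ∏ j, unitPowSum k p ((a j : ZMod p) * v)‖
      ≤ ((p : ℝ) - 1)⁻¹ ^ (n + 1) * ((p - 1) * ((p - 1) * (k * Real.sqrt p) ^ n)) := by gcongr
    _ = (p - 1) * (k * Real.sqrt p / (p - 1)) ^ n := by
        rw [inv_pow, pow_succ, div_pow]
        field_simp
    _ ≤ p * (2 * k * (1 / Real.sqrt p)) ^ n := by
        gcongr
        · linarith
        · rw [div_le_iff₀ hpm]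
          have h5 : k * Real.sqrt p = 2 * k * (1 / Real.sqrt p) * (p / 2) := by
            rw [show (p : ℝ) / 2 = Real.sqrt p ^ 2 / 2 by rw [hsq2]]
            field_simp
          rw [h5]
          gcongr
          linarith
    _ = (2 * k) ^ n * (p * (1 / Real.sqrt p) ^ n) := by rw [mul_pow]; ring
    _ ≤ (2 * k) ^ (n + 1) * (p * (1 / Real.sqrt p) ^ 5) := by
        refine mul_le_mul ?_ ?_ (by positivity) (by positivity)
        · exact pow_le_pow_right₀ (by linarith) (by omega)
        · refine mul_le_mul_of_nonneg_left ?_ (by positivity)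
          refine pow_le_pow_of_le_one (by positivity) ?_ (by omega)
          rw [div_le_one (by positivity)]
          exact hsq
    _ = _ := by
        congr 1
        have : Real.sqrt p ≠ 0 := by positivity
        field_simp
        exact hsq2.symm

/-- The product of the greatest common divisors of all pairs of distinct entries. -/
def gcdProd {s : ℕ} (a : Fin s → ℤ) : ℕ :=
  ∏ x ∈ (Finset.univ : Finset (Fin s)).offDiag, Int.gcd (a x.1) (a x.2)

lemma gcdProd_ne_zero {s : ℕ} {a : Fin s → ℤ} (ha : ∀ j, a j ≠ 0) : gcdProd a ≠ 0 :=
  Finset.prod_ne_zero_iff.2 fun x _ h => ha x.1 (Int.gcd_eq_zero_iff.1 h).1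

lemma gcd_dvd_gcdProd {s : ℕ} (a : Fin s → ℤ) {i j : Fin s} (h : i ≠ j) :
    Int.gcd (a i) (a j) ∣ gcdProd a :=
  Finset.dvd_prod_of_mem (a := (i, j)) (fun x : Fin s × Fin s => Int.gcd (a x.1) (a x.2))
    (Finset.mem_offDiag.2 ⟨Finset.mem_univ i, Finset.mem_univ j, h⟩)

lemma exists_eq_pow_mul_not_dvd {p : ℕ} (hp : p.Prime) {s : ℕ} {a : Fin s → ℤ}
    (i₁ i₂ : Fin s) (ha : a i₁ ≠ 0) :
    ∃ j, ∃ b : ℤ, a j = p ^ ((Int.gcd (a i₁) (a i₂)).factorization p) * b ∧ ¬ (p : ℤ) ∣ b := by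
  set g := Int.gcd (a i₁) (a i₂) with hg
  have hg0 : g ≠ 0 := fun h => ha (Int.gcd_eq_zero_iff.1 h).1
  set m := g.factorization p with hm
  have hd : ((p ^ m : ℕ) : ℤ) ∣ g := by exact_mod_cast Nat.ordProj_dvd g p
  obtain ⟨b₁, h₁⟩ := hd.trans (Int.gcd_dvd_left (a i₁) (a i₂))
  obtain ⟨b₂, h₂⟩ := hd.trans (Int.gcd_dvd_right (a i₁) (a i₂))
  by_contra! hcon
  have hd₁ := hcon i₁ b₁ (by rw [h₁]; push_cast; rfl)
  have hd₂ := hcon i₂ b₂ (by rw [h₂]; push_cast; rfl)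
  have h3 : ((p ^ (m + 1) : ℕ) : ℤ) ∣ g := by
    apply Int.dvd_coe_gcd
    · rw [h₁, pow_succ]; push_cast; exact mul_dvd_mul_left _ hd₁
    · rw [h₂, pow_succ]; push_cast; exact mul_dvd_mul_left _ hd₂
  have h4 := (hp.pow_dvd_iff_le_factorization hg0).1 (by exact_mod_cast h3 : p ^ (m + 1) ∣ g)
  omega

lemma exists_eulerFactor_lower_bound {k s : ℕ} (hk : 2 ≤ k) (hs : 6 ≤ s) {a : Fin s → ℤ}
    (ha : ∀ j, a j ≠ 0) {p : ℕ} (hp : p.Prime) :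
    ∃ x : ℝ, ∑' e, Tsum k a (p ^ e) = x ∧ (x ≠ 0 → 0 ≤ x ∧
      (((p : ℝ) ^ (2 * k.factorization p + 1)) ^ s)⁻¹ ≤
        x * ((p : ℝ) ^ (gcdProd a).factorization p) ^ (2 * s) ∧
      (¬ p ∣ k → 1 - (2 * k) ^ s * (1 / Real.sqrt p ^ 3) ≤
        x * ((p : ℝ) ^ (gcdProd a).factorization p) ^ (2 * s))) := by
  let i₁ : Fin s := ⟨0, by omega⟩
  let i₂ : Fin s := ⟨1, by omega⟩
  have hi : i₁ ≠ i₂ := by simp [i₁, i₂]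
  have hp1 : (1 : ℝ) ≤ p := by exact_mod_cast hp.one_lt.le
  have hp0 : (0 : ℝ) < p := by linarith
  obtain ⟨j, b, hj, hb⟩ := exists_eq_pow_mul_not_dvd hp i₁ i₂ (ha i₁)
  set m := (Int.gcd (a i₁) (a i₂)).factorization p with hm
  have hmn : m ≤ (gcdProd a).factorization p :=
    (Nat.factorization_le_iff_dvd (fun h => ha i₁ (Int.gcd_eq_zero_iff.1 h).1)
      (gcdProd_ne_zero ha)).2 (gcd_dvd_gcdProd a hi) p
  set n := (gcdProd a).factorization p with hn
  set v := k.factorization p with hv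
  have hk1 : k = p ^ v * (k / p ^ v) := (Nat.ordProj_mul_ordCompl_eq_self k p).symm
  have hk2 : ¬ p ∣ k / p ^ v := Nat.not_dvd_ordCompl hp (by omega)
  obtain ⟨x, hx, hx2⟩ := exists_tsum_Tsum_prime_pow_eq hp hk1 hk2 j hj hb
  refine ⟨x, hx, fun hx0 => ?_⟩
  have hxl := hx2 hx0
  have hxnn : 0 ≤ x := le_trans (by positivity) hxl
  have hxl' : ∀ e : ℕ, (((p : ℝ) ^ e) ^ s)⁻¹ * ((p : ℝ) ^ (m + 2 * v + 1)) ^ s ≤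
      ((p : ℝ) ^ n) ^ (2 * s) → (((p : ℝ) ^ e) ^ s)⁻¹ ≤ x * ((p : ℝ) ^ n) ^ (2 * s) := by
    intro e he
    calc (((p : ℝ) ^ e) ^ s)⁻¹ = (((p : ℝ) ^ (m + 2 * v + 1)) ^ s)⁻¹ *
          ((((p : ℝ) ^ e) ^ s)⁻¹ * ((p : ℝ) ^ (m + 2 * v + 1)) ^ s) := by field_simp
      _ ≤ _ := mul_le_mul hxl he (by positivity) hxnn
  refine ⟨hxnn, hxl' _ ?_, fun hpk => ?_⟩
  · rw [inv_mul_le_iff₀ (by positivity), ← pow_mul, ← pow_mul, ← pow_mul, ← pow_add]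
    refine pow_le_pow_right₀ hp1 ?_
    nlinarith [Nat.mul_le_mul_right s hmn]
  · have hv0 : v = 0 := Nat.factorization_eq_zero_of_not_dvd hpk
    by_cases hpG : p ∣ gcdProd a
    · have hn1 : 1 ≤ n := (hp.dvd_iff_one_le_factorization (gcdProd_ne_zero ha)).1 hpG
      have h1 := hxl' 0 ?_
      · rw [pow_zero, one_pow, inv_one] at h1
        refine le_trans ?_ h1
        have : (0 : ℝ) ≤ (2 * k) ^ s * (1 / Real.sqrt p ^ 3) := by positivity
        linarith
      · rw [pow_zero, one_pow, inv_one, one_mul, hv0, ← pow_mul, ← pow_mul]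
        refine pow_le_pow_right₀ hp1 ?_
        nlinarith [Nat.mul_le_mul_right s hmn, Nat.mul_le_mul_right s hn1]
    · have hn0 : n = 0 := Nat.factorization_eq_zero_of_not_dvd hpG
      have hm0 : m = 0 := by omega
      rw [hn0, pow_zero, one_pow, mul_one]
      have h1 := tsum_Tsum_prime_pow hp hk1 hk2 j hj hb
      rw [hx, hm0, hv0] at h1
      simp only [mul_zero, zero_add, Finset.sum_range_succ, Finset.range_zero, Finset.sum_empty,
        pow_zero, pow_one, Tsum_one] at h1
      have hj₀ : ∃ j₀ : Fin s, ∀ j, j ≠ j₀ → ¬ (p : ℤ) ∣ a j := by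
        by_cases h : ∃ j₀, (p : ℤ) ∣ a j₀
        · obtain ⟨j₀, hj₀⟩ := h
          refine ⟨j₀, fun i hi hpi => hpG ?_⟩
          refine dvd_trans ?_ (gcd_dvd_gcdProd a hi)
          exact_mod_cast Int.dvd_coe_gcd hpi hj₀
        · exact ⟨i₁, fun i _ hpi => h ⟨i, hpi⟩⟩
      obtain ⟨j₀, hj₀⟩ := hj₀
      have h2 := norm_Tsum_prime_le hp (by omega : 0 < k) hs j₀ hj₀
      have h3 : Tsum k a p = ((x - 1 : ℝ) : ℂ) := by
        push_cast
        rw [h1]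
        ring
      rw [h3, Complex.norm_real, Real.norm_eq_abs] at h2
      linarith [(abs_le.1 h2).1]

lemma one_sub_sum_le_prod_one_sub {ι : Type*} (t : Finset ι) (f : ι → ℝ)
    (h0 : ∀ i ∈ t, 0 ≤ f i) (h1 : ∀ i ∈ t, f i ≤ 1) :
    1 - ∑ i ∈ t, f i ≤ ∏ i ∈ t, (1 - f i) := by
  induction t using Finset.cons_induction with
  | empty => simp
  | cons i t hi ih =>
    rw [Finset.sum_cons, Finset.prod_cons]
    have h2 := ih (fun j hj => h0 j (Finset.mem_cons_of_mem hj))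
      (fun j hj => h1 j (Finset.mem_cons_of_mem hj))
    have h3 := h0 i (Finset.mem_cons_self i t)
    have h4 := h1 i (Finset.mem_cons_self i t)
    have h5 : 0 ≤ ∑ j ∈ t, f j := Finset.sum_nonneg fun j hj => h0 j (Finset.mem_cons_of_mem hj)
    nlinarith

lemma prod_primesBelow_pow_factorization_le (N : ℕ) {G : ℕ} (hG : G ≠ 0) :
    ∏ p ∈ N.primesBelow, p ^ G.factorization p ≤ G := by
  conv_rhs => rw [← Nat.prod_factorization_pow_eq_self hG]
  rw [Finsupp.prod_of_support_subset (s := N.primesBelow ∪ G.factorization.support) _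
    Finset.subset_union_right _ (by simp)]
  refine Finset.prod_le_prod_of_subset_of_one_le' Finset.subset_union_left fun p hp _ => ?_
  rcases Finset.mem_union.1 hp with h | h
  · exact Nat.one_le_pow _ _ (Nat.prime_of_mem_primesBelow h).pos
  · exact Nat.one_le_pow _ _ (Nat.prime_of_mem_primeFactors h).pos

lemma exists_singSeries_lower_bound {k s : ℕ} (hk : 2 ≤ k) (hs : 6 ≤ s) :
    ∃ c : ℝ, 0 < c ∧ ∀ a : Fin s → ℤ, (∀ j, a j ≠ 0) → 0 < (singSeries k a).re →
      c ≤ (singSeries k a).re * (gcdProd a : ℝ) ^ (2 * s) := by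
  set f : ℕ → ℝ := fun p => (2 * k) ^ s * (1 / Real.sqrt p ^ 3) with hf
  have hf0 : ∀ p, 0 ≤ f p := fun p => by positivity
  have hfs : Summable f := by
    apply Summable.mul_left
    have h := Real.summable_one_div_nat_rpow.2 (by norm_num : (1 : ℝ) < 3 / 2)
    refine h.congr fun n => ?_
    rw [Real.sqrt_eq_rpow, ← Real.rpow_natCast, ← Real.rpow_mul (by positivity)]
    norm_num
  obtain ⟨t₀, ht₀⟩ := summable_iff_vanishing_norm.1 hfs (1 / 2) (by norm_num)
  obtain ⟨M₀, hM₀⟩ := t₀.exists_nat_subset_range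
  set M := max M₀ (k + 1) with hM
  have htail : ∀ t : Finset ℕ, (∀ i ∈ t, M ≤ i) → ∑ i ∈ t, f i < 1 / 2 := by
    intro t ht
    refine lt_of_le_of_lt (le_abs_self _) (ht₀ t ?_)
    refine Finset.disjoint_left.2 fun i hi hi' => ?_
    have := Finset.mem_range.1 (hM₀ hi')
    have := ht i hi
    omega
  have hf1 : ∀ i, M ≤ i → f i ≤ 1 := by
    intro i hi
    have := htail {i} (by simpa using hi)
    rw [Finset.sum_singleton] at this
    linarith
  set B : ℕ → ℝ := fun p => (((p : ℝ) ^ (2 * k.factorization p + 1)) ^ s)⁻¹ with hB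
  have hBpos : 0 < ∏ p ∈ M.primesBelow, B p := by
    refine Finset.prod_pos fun p hp => ?_
    have : (0 : ℝ) < p := by exact_mod_cast (Nat.prime_of_mem_primesBelow hp).pos
    positivity
  refine ⟨(∏ p ∈ M.primesBelow, B p) * (1 / 2), by positivity, fun a ha hre => ?_⟩
  have hsum' : Summable fun q => Tsum k a (q + 1) := by
    by_contra h
    rw [singSeries, tsum_eq_zero_of_not_summable h] at hre
    simp at hre
  have hsum : Summable (Tsum k a) := (summable_nat_add_iff 1).1 hsum'
  have hS : singSeries k a = ∑' q, Tsum k a q := by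
    rw [hsum.tsum_eq_zero_add, Tsum_zero, zero_add, singSeries]
  have hE := EulerProduct.eulerProduct (Tsum_one k a) (fun h => Tsum_mul k a h) hsum.norm
    (Tsum_zero k a)
  rw [← hS] at hE
  have hx : ∀ p : ℕ, ∃ x : ℝ, p.Prime → ∑' e, Tsum k a (p ^ e) = x ∧ (x ≠ 0 → 0 ≤ x ∧
      B p ≤ x * ((p : ℝ) ^ (gcdProd a).factorization p) ^ (2 * s) ∧
      (¬ p ∣ k → 1 - f p ≤ x * ((p : ℝ) ^ (gcdProd a).factorization p) ^ (2 * s))) := by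
    intro p
    by_cases hp : p.Prime
    · obtain ⟨x, hx⟩ := exists_eulerFactor_lower_bound hk hs ha hp
      exact ⟨x, fun _ => hx⟩
    · exact ⟨0, fun h => absurd h hp⟩
  choose x hx using hx
  have hx0 : ∀ p, p.Prime → x p ≠ 0 := by
    intro p hp h0
    have h1 : Tendsto (fun n : ℕ => ∏ p ∈ n.primesBelow, ∑' e, Tsum k a (p ^ e)) atTop (nhds 0) := by
      refine tendsto_const_nhds.congr' ?_
      filter_upwards [eventually_gt_atTop p] with n hn
      refine (Finset.prod_eq_zero (Nat.mem_primesBelow.2 ⟨hn, hp⟩) ?_).symm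
      rw [(hx p hp).1, h0, Complex.ofReal_zero]
    have h2 := tendsto_nhds_unique hE h1
    rw [h2] at hre
    simp at hre
  have hEr : Tendsto (fun n : ℕ => ∏ p ∈ n.primesBelow, x p) atTop (nhds (singSeries k a).re) := by
    refine ((Complex.continuous_re.tendsto _).comp hE).congr fun n => ?_
    rw [Function.comp_apply, Finset.prod_congr rfl
      fun p hp => (hx p (Nat.prime_of_mem_primesBelow hp)).1, ← Complex.ofReal_prod,
      Complex.ofReal_re]
  refine ge_of_tendsto (hEr.mul_const _) ?_
  filter_upwards [eventually_ge_atTop M] with N hN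
  have hxnn : ∀ p ∈ N.primesBelow, 0 ≤ x p := fun p hp =>
    ((hx p (Nat.prime_of_mem_primesBelow hp)).2 (hx0 p (Nat.prime_of_mem_primesBelow hp))).1
  have hsplit : (N.primesBelow).filter (fun p => p < M) = M.primesBelow := by
    ext p
    simp only [Finset.mem_filter, Nat.mem_primesBelow]
    constructor
    · rintro ⟨⟨_, h⟩, h'⟩
      exact ⟨h', h⟩
    · rintro ⟨h, h'⟩
      exact ⟨⟨by omega, h'⟩, h⟩
  have hG := prod_primesBelow_pow_factorization_le N (gcdProd_ne_zero ha)
  have hG' : ∏ p ∈ N.primesBelow, (p : ℝ) ^ (gcdProd a).factorization p ≤ gcdProd a := by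
    exact_mod_cast hG
  calc (∏ p ∈ M.primesBelow, B p) * (1 / 2)
      ≤ (∏ p ∈ M.primesBelow, B p) *
          ∏ p ∈ N.primesBelow with ¬ p < M, (1 - f p) := by
        refine mul_le_mul_of_nonneg_left ?_ hBpos.le
        have hge : ∀ i ∈ (N.primesBelow).filter (fun p => ¬ p < M), M ≤ i := fun i hi =>
          not_lt.1 (Finset.mem_filter.1 hi).2
        refine le_trans ?_ (one_sub_sum_le_prod_one_sub _ f (fun i _ => hf0 i)
          fun i hi => hf1 i (hge i hi))
        linarith [htail _ hge]
    _ = ∏ p ∈ N.primesBelow, if p < M then B p else 1 - f p := by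
        rw [Finset.prod_ite, hsplit]
    _ ≤ ∏ p ∈ N.primesBelow, x p * ((p : ℝ) ^ (gcdProd a).factorization p) ^ (2 * s) := by
        refine Finset.prod_le_prod (fun p hp => ?_) fun p hp => ?_
        · split_ifs with h
          · positivity
          · linarith [hf1 p (not_lt.1 h)]
        · have hp' := Nat.prime_of_mem_primesBelow hp
          have h3 := ((hx p hp').2 (hx0 p hp')).2
          split_ifs with h
          · exact h3.1
          · refine h3.2 fun hd => ?_
            have := Nat.le_of_dvd (by omega) hd
            omega
    _ = (∏ p ∈ N.primesBelow, x p) *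
          (∏ p ∈ N.primesBelow, (p : ℝ) ^ (gcdProd a).factorization p) ^ (2 * s) := by
        rw [Finset.prod_mul_distrib, Finset.prod_pow]
    _ ≤ _ := by
        refine mul_le_mul_of_nonneg_left ?_ (Finset.prod_nonneg hxnn)
        refine pow_le_pow_left₀ (Finset.prod_nonneg fun p _ => by positivity) hG' _

/-- The nonzero multiples of `d` of absolute value at most `N`. -/
def nonzeroMultiples (N d : ℕ) : Finset ℤ :=
  (Finset.Icc (-(N : ℤ)) N).filter fun x => x ≠ 0 ∧ (d : ℤ) ∣ x

lemma card_nonzeroMultiples_le (N d : ℕ) : (nonzeroMultiples N d).card ≤ 2 * (N / d) := by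
  have h : nonzeroMultiples N d ⊆
      ((Finset.Icc (-((N / d : ℕ) : ℤ)) ((N / d : ℕ) : ℤ)).erase 0).image fun x => (d : ℤ) * x := by
    intro x hx
    simp only [nonzeroMultiples, Finset.mem_filter, Finset.mem_Icc] at hx
    obtain ⟨⟨h1, h2⟩, h0, c, rfl⟩ := hx
    have hd : 0 < d := by
      rcases Nat.eq_zero_or_pos d with rfl | h
      · simp at h0
      · exact h
    refine Finset.mem_image.2 ⟨c, Finset.mem_erase.2 ⟨fun hc => h0 (by simp [hc]), ?_⟩, rfl⟩
    have h3 : c.natAbs ≤ N / d := by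
      rw [Nat.le_div_iff_mul_le hd]
      have h4 : ((d : ℤ) * c).natAbs ≤ N := by omega
      rwa [Int.natAbs_mul, Int.natAbs_natCast, mul_comm] at h4
    rw [Finset.mem_Icc]
    omega
  refine (Finset.card_le_card h).trans (Finset.card_image_le.trans ?_)
  generalize N / d = n
  rw [Finset.card_erase_of_mem (by simp), Int.card_Icc]
  omega

lemma ncard_exists_lt_gcd_le {s : ℕ} {A y : ℝ} (hA : 0 ≤ A) (hy : 0 < y) :
    {a : Fin s → ℤ | (∀ j, a j ≠ 0) ∧ hgt a ≤ A ∧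
      ∃ i j, i ≠ j ∧ y < (Int.gcd (a i) (a j) : ℝ)}.Finite ∧
    ({a : Fin s → ℤ | (∀ j, a j ≠ 0) ∧ hgt a ≤ A ∧
      ∃ i j, i ≠ j ∧ y < (Int.gcd (a i) (a j) : ℝ)}.ncard : ℝ) ≤ s ^ 2 * ((2 * A) ^ s * (2 / y)) := by
  set N := ⌊A⌋₊ with hN
  let e : Fin s × Fin s → ℕ → Fin s → ℕ := fun x d l =>
    (if l = x.1 then d else 1) * (if l = x.2 then d else 1)
  let T : Finset (Fin s → ℤ) := (Finset.univ : Finset (Fin s)).offDiag.biUnion fun x =>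
    (Finset.Ioo ⌊y⌋₊ (N + 1)).biUnion fun d => Fintype.piFinset fun l => nonzeroMultiples N (e x d l)
  have hsub : {a : Fin s → ℤ | (∀ j, a j ≠ 0) ∧ hgt a ≤ A ∧
      ∃ i j, i ≠ j ∧ y < (Int.gcd (a i) (a j) : ℝ)} ⊆ (T : Set (Fin s → ℤ)) := by
    rintro a ⟨ha0, haA, i, j, hij, hg⟩
    have hle : ∀ l, (a l).natAbs ≤ N := fun l => by
      refine (Finset.le_sup (f := fun j => (a j).natAbs) (Finset.mem_univ l)).trans ?_
      exact Nat.le_floor haA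
    refine Finset.mem_coe.2 (Finset.mem_biUnion.2 ⟨(i, j),
      Finset.mem_offDiag.2 ⟨Finset.mem_univ _, Finset.mem_univ _, hij⟩,
      Finset.mem_biUnion.2 ⟨Int.gcd (a i) (a j), Finset.mem_Ioo.2 ⟨(Nat.floor_lt hy.le).2 hg, ?_⟩,
        Fintype.mem_piFinset.2 fun l => ?_⟩⟩)
    · have h1 : Int.gcd (a i) (a j) ≤ (a i).natAbs :=
        Nat.le_of_dvd (Int.natAbs_pos.2 (ha0 i)) (Int.natCast_dvd.1 (Int.gcd_dvd_left _ _))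
      have := hle i
      omega
    · have hl := hle l
      refine Finset.mem_filter.2 ⟨Finset.mem_Icc.2 (by omega), ha0 l, ?_⟩
      simp only [e]
      by_cases h1 : l = i
      · subst h1
        simpa [hij] using Int.gcd_dvd_left (a l) (a j)
      · by_cases h2 : l = j
        · subst h2
          simpa [h1] using Int.gcd_dvd_right (a i) (a l)
        · simp [h1, h2]
  refine ⟨T.finite_toSet.subset hsub, ?_⟩
  have hcard : ∀ x d, ((Fintype.piFinset fun l => nonzeroMultiples N (e x d l)).card : ℝ) ≤
      (2 * A) ^ s * ((d : ℝ) ^ 2)⁻¹ := by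
    intro x d
    rw [Fintype.card_piFinset]
    push_cast
    calc ∏ l, ((nonzeroMultiples N (e x d l)).card : ℝ)
        ≤ ∏ l, (2 * A) * ((if l = x.1 then (d : ℝ)⁻¹ else 1) * (if l = x.2 then (d : ℝ)⁻¹ else 1)) := by
          refine Finset.prod_le_prod (fun _ _ => by positivity) fun l _ => ?_
          have h1 : ((nonzeroMultiples N (e x d l)).card : ℝ) ≤ 2 * (N / (e x d l : ℕ)) := by
            refine le_trans (Nat.cast_le.2 (card_nonzeroMultiples_le N (e x d l))) ?_
            push_cast
            gcongr
            exact Nat.cast_div_le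
          have h2 : (N : ℝ) ≤ A := Nat.floor_le hA
          have h3 : ((e x d l : ℕ) : ℝ)⁻¹ =
              (if l = x.1 then (d : ℝ)⁻¹ else 1) * (if l = x.2 then (d : ℝ)⁻¹ else 1) := by
            simp only [e]
            split_ifs <;> simp
          rw [← h3, mul_assoc, ← div_eq_mul_inv]
          refine h1.trans ?_
          gcongr
      _ = _ := by
          have h : ∏ l, ((if l = x.1 then (d : ℝ)⁻¹ else 1) * (if l = x.2 then (d : ℝ)⁻¹ else 1)) =
              ((d : ℝ) ^ 2)⁻¹ := by
            rw [Finset.prod_mul_distrib]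
            simp [sq]
          rw [Finset.prod_mul_distrib, h, Finset.prod_const, Finset.card_univ, Fintype.card_fin]
  calc _ ≤ (T.card : ℝ) := by
        rw [← Set.ncard_coe_finset T]
        exact_mod_cast Set.ncard_le_ncard hsub T.finite_toSet
    _ ≤ ∑ x ∈ (Finset.univ : Finset (Fin s)).offDiag, ∑ d ∈ Finset.Ioo ⌊y⌋₊ (N + 1),
          ((Fintype.piFinset fun l => nonzeroMultiples N (e x d l)).card : ℝ) := by
        exact_mod_cast Finset.card_biUnion_le.trans
          (Finset.sum_le_sum fun x _ => Finset.card_biUnion_le)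
    _ ≤ ∑ x ∈ (Finset.univ : Finset (Fin s)).offDiag, (2 * A) ^ s * (2 / y) := by
        refine Finset.sum_le_sum fun x _ => ?_
        refine (Finset.sum_le_sum fun d _ => hcard x d).trans ?_
        rw [← Finset.mul_sum]
        gcongr
        refine (sum_Ioo_inv_sq_le _ _).trans ?_
        gcongr
        exact (Nat.lt_floor_add_one y).le
    _ ≤ _ := by
        rw [Finset.sum_const, nsmul_eq_mul]
        gcongr
        rw [Finset.offDiag_card, Finset.card_univ, Fintype.card_fin, sq]
        exact_mod_cast Nat.sub_le _ _

theorem stmt3 (k s : ℕ) (hk : 2 ≤ k) (hs : 6 ≤ s) :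
    ∃ c₁ c₂ : ℝ, 0 < c₁ ∧ 0 < c₂ ∧ ∀ η : ℝ, 0 < η →
      ∃ δ K : ℝ, 0 < δ ∧ c₁ * η ≤ δ ∧ δ ≤ c₂ * η ∧ 0 < K ∧ ∀ A : ℝ, 3 ≤ A →
        ({a : Fin s → ℤ | (∀ j, a j ≠ 0) ∧ hgt a ≤ A ∧
            (singSeries k a).im = 0 ∧ 0 < (singSeries k a).re ∧
            (singSeries k a).re < Real.log A ^ (-η)}.ncard : ℝ)
          ≤ K * A ^ s / Real.log A ^ δ := by
  obtain ⟨c, hc, hlow⟩ := exists_singSeries_lower_bound hk hs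
  set P := ((Finset.univ : Finset (Fin s)).offDiag).card with hP
  have hPpos : 0 < P := by
    rw [hP, Finset.offDiag_card, Finset.card_univ, Fintype.card_fin]
    have : s * 1 < s * s := by nlinarith
    omega
  set E : ℕ := P * (2 * s) with hE
  have hEpos : 0 < E := Nat.mul_pos hPpos (by omega)
  have hE' : (0 : ℝ) < E := by exact_mod_cast hEpos
  refine ⟨1 / E, 1 / E, by positivity, by positivity, fun η hη => ?_⟩
  refine ⟨1 / E * η, s ^ 2 * 2 ^ s * 2 / c ^ (1 / E : ℝ), by positivity, le_rfl, le_rfl,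
    by have : 0 < s := by omega
       positivity, fun A hA => ?_⟩
  have hL : 0 < Real.log A := Real.log_pos (by linarith)
  set y : ℝ := c ^ (1 / E : ℝ) * Real.log A ^ (1 / E * η) with hy
  have hy0 : 0 < y := by positivity
  have hyE : y ^ E = c * Real.log A ^ η := by
    rw [hy, mul_pow, ← Real.rpow_natCast, ← Real.rpow_natCast, ← Real.rpow_mul hc.le,
      ← Real.rpow_mul hL.le]
    congr 2
    · field_simp
      exact Real.rpow_one c
    · field_simp
  obtain ⟨hfin, hcount⟩ := ncard_exists_lt_gcd_le (s := s) (A := A) (y := y) (by linarith) hy0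
  refine le_trans ?_ (hcount.trans (le_of_eq ?_))
  · refine Nat.cast_le.2 (Set.ncard_le_ncard ?_ hfin)
    rintro a ⟨ha0, haA, -, hpos, hlt⟩
    refine ⟨ha0, haA, ?_⟩
    by_contra! hcon
    have hG : (gcdProd a : ℝ) ≤ y ^ P := by
      rw [gcdProd, Nat.cast_prod, hP, ← Finset.prod_const]
      exact Finset.prod_le_prod (fun _ _ => by positivity) fun x hx =>
        hcon x.1 x.2 (Finset.mem_offDiag.1 hx).2.2
    have hG' : (gcdProd a : ℝ) ^ (2 * s) ≤ c * Real.log A ^ η := by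
      rw [← hyE, hE, pow_mul y]
      gcongr
    have h1 := hlow a ha0 hpos
    have h2 : c < c := calc
      c ≤ (singSeries k a).re * (gcdProd a : ℝ) ^ (2 * s) := h1
      _ ≤ (singSeries k a).re * (c * Real.log A ^ η) := by gcongr
      _ < Real.log A ^ (-η) * (c * Real.log A ^ η) := by gcongr
      _ = c := by
        rw [Real.rpow_neg hL.le]
        have := (Real.rpow_pos_of_pos hL η).ne'
        field_simp
    exact lt_irrefl _ h2
  · rw [hy, mul_pow]
    field_simp
end
end

section
/- Let k ≥ 2 and s ≥ 4. For each prime p, the limit δ_p = lim_{A→∞} #{tuples a of nonzero integers with |a| ≤ A and a ∈ C_p(k,s)}/(2A)^s exists and is positive. Setting δ_∞ = 1 − 2^{1−s}, the infinite product 𝔇_{s,k} = δ_∞·∏_p δ_p over all primes converges, and there is a constant K > 0 such that for all A ≥ 3: |#{a ∈ C'(k,s) : |a| ≤ A} − 𝔇_{s,k}·(2A)^s| ≤ K·A^s/(log A)^{s−3}. -/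
open scoped BigOperators Classical
open Filter

noncomputable section

/-- Solubility of `∑ a_j x_j^k = 0` in positive reals. -/
def solRplus (k : ℕ) {s : ℕ} (a : Fin s → ℤ) : Prop :=
  ∃ x : Fin s → ℝ, (∀ j, 0 < x j) ∧ ∑ j, (a j : ℝ) * x j ^ k = 0

/-- Solubility of `∑ a_j x_j^k = 0` in `p`-adic units. -/
def solZpUnit (k : ℕ) {s : ℕ} (p : ℕ) [Fact p.Prime] (a : Fin s → ℤ) : Prop :=
  ∃ x : Fin s → ℤ_[p], (∀ j, IsUnit (x j)) ∧ ∑ j, (a j : ℤ_[p]) * x j ^ k = 0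

/-- `a ∈ C'(k,s)`: real-positive solubility together with solubility in `p`-adic
units for every prime `p`. -/
def memC' (k : ℕ) {s : ℕ} (a : Fin s → ℤ) : Prop :=
  solRplus k a ∧ ∀ (p : ℕ) [Fact p.Prime], solZpUnit k p a

theorem PadicInt.dvd_of_norm_le {p : ℕ} [Fact p.Prime] {x y : ℤ_[p]} (h : ‖x‖ ≤ ‖y‖) : y ∣ x := by
  rcases eq_or_ne y 0 with rfl | hy
  · have : x = 0 := by simpa using h
    simp [this]
  · have hy' : (y : ℚ_[p]) ≠ 0 := by simpa using hy
    have hq : ‖(x : ℚ_[p]) / y‖ ≤ 1 := by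
      rw [norm_div]
      exact div_le_one_of_le₀ (by simpa using h) (norm_nonneg _)
    refine ⟨⟨(x : ℚ_[p]) / y, hq⟩, ?_⟩
    apply Subtype.ext
    change (x : ℚ_[p]) = y * (x / y)
    field_simp

/-- A `p`-adic integer close enough to `1` is a `k`-th power of a unit. -/
theorem PadicInt.exists_isUnit_pow_eq {p : ℕ} [Fact p.Prime] {k : ℕ} (hk : k ≠ 0) {u : ℤ_[p]}
    (h : ‖u - 1‖ < ‖(k : ℤ_[p])‖ ^ 2) : ∃ t : ℤ_[p], IsUnit t ∧ t ^ k = u := by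
  obtain ⟨t, ht, -⟩ := hensels_lemma (p := p) (R := ℤ_[p]) (F := Polynomial.X ^ k - Polynomial.C u)
    (a := 1) (by
      simpa [norm_sub_rev, Polynomial.derivative_X_pow] using h)
  have htu : t ^ k = u := by simpa [sub_eq_zero] using ht
  refine ⟨t, ?_, htu⟩
  rw [← isUnit_pow_iff hk, htu, PadicInt.isUnit_iff]
  have h1 : ‖u - 1‖ < 1 := h.trans_le (pow_le_one₀ (norm_nonneg _) (PadicInt.norm_le_one _))
  by_contra hu
  have hu' : ‖u‖ < 1 := lt_of_le_of_ne (PadicInt.norm_le_one _) hu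
  have : ‖u + (1 - u)‖ < 1 := (PadicInt.nonarchimedean _ _).trans_lt
    (by simpa [norm_sub_rev] using ⟨hu', h1⟩)
  simp at this

theorem solZpUnit_of_norm_lt {k s p : ℕ} [Fact p.Prime] (hk : k ≠ 0) {a : Fin s → ℤ}
    {x : Fin s → ℤ_[p]} (hx : ∀ j, IsUnit (x j)) (j : Fin s)
    (h : ‖∑ i, (a i : ℤ_[p]) * x i ^ k‖ < ‖(a j : ℤ_[p])‖ * ‖(k : ℤ_[p])‖ ^ 2) :
    solZpUnit k p a := by
  have hk1 : ‖(k : ℤ_[p])‖ ^ 2 ≤ 1 := pow_le_one₀ (norm_nonneg _) (PadicInt.norm_le_one _)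
  obtain ⟨c, hc⟩ := PadicInt.dvd_of_norm_le
    (h.le.trans (mul_le_of_le_one_right (norm_nonneg _) hk1))
  have hc' : ‖c‖ < ‖(k : ℤ_[p])‖ ^ 2 := by
    rw [hc, norm_mul] at h
    exact lt_of_mul_lt_mul_left h (norm_nonneg _)
  obtain ⟨v, hv⟩ := (hx j).pow k
  obtain ⟨t, ht, htk⟩ := PadicInt.exists_isUnit_pow_eq hk (u := 1 - c * (↑v⁻¹ : ℤ_[p])) (by
    have : ‖(↑v⁻¹ : ℤ_[p])‖ = 1 := PadicInt.isUnit_iff.1 v⁻¹.isUnit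
    simpa [this] using hc')
  refine ⟨Function.update x j (x j * t), fun i => ?_, ?_⟩
  · rcases eq_or_ne i j with rfl | hij
    · simpa using ⟨hx i, ht⟩
    · simpa [hij] using hx i
  · rw [← Finset.add_sum_erase _ _ (Finset.mem_univ j)] at hc ⊢
    rw [Finset.sum_congr rfl (g := fun i => (a i : ℤ_[p]) * x i ^ k)
      fun i hi => by rw [Function.update_of_ne (Finset.ne_of_mem_erase hi)]]
    have hvv : x j ^ k * (↑v⁻¹ : ℤ_[p]) = 1 := by rw [← hv, Units.mul_inv]
    rw [Function.update_self, mul_pow, htk]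
    linear_combination hc - (a j : ℤ_[p]) * c * hvv

/-- Solubility in units, away from multiples of `p ^ f`, is a congruence condition. -/
theorem solZpUnit_of_dvd_sub {k s p f : ℕ} [hp : Fact p.Prime] (hk : k ≠ 0) {a b : Fin s → ℤ}
    (hab : ∀ i, ((p ^ (f + 2 * padicValNat p k) : ℕ) : ℤ) ∣ b i - a i)
    (hb : ¬ ∀ i, ((p ^ f : ℕ) : ℤ) ∣ b i) (ha : solZpUnit k p a) : solZpUnit k p b := by
  obtain ⟨x, hx, hsum⟩ := ha
  obtain ⟨j, hj⟩ := not_forall.1 hb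
  have hkn : ‖(k : ℤ_[p])‖ ^ 2 = (p : ℝ) ^ (-(2 * padicValNat p k : ℕ) : ℤ) := by
    rw [PadicInt.norm_def]
    push_cast
    rw [Padic.norm_eq_zpow_neg_valuation (by exact_mod_cast hk), Padic.valuation_natCast,
      ← zpow_natCast, ← zpow_mul]
    congr 1
    push_cast
    ring
  have hp0 : (0 : ℝ) < p := by exact_mod_cast hp.out.pos
  have hbj : (p : ℝ) ^ (-f : ℤ) < ‖(b j : ℤ_[p])‖ := by
    rw [← not_le, PadicInt.norm_int_le_pow_iff_dvd]
    exact_mod_cast hj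
  refine solZpUnit_of_norm_lt hk hx j ?_
  have hdiff : ∑ i, (b i : ℤ_[p]) * x i ^ k = ∑ i, ((b i - a i : ℤ) : ℤ_[p]) * x i ^ k := by
    rw [← sub_zero (∑ i, (b i : ℤ_[p]) * x i ^ k), ← hsum, ← Finset.sum_sub_distrib]
    refine Finset.sum_congr rfl fun i _ => ?_
    push_cast
    ring
  have hle : ‖∑ i, (b i : ℤ_[p]) * x i ^ k‖ ≤
      (p : ℝ) ^ (-(f + 2 * padicValNat p k : ℕ) : ℤ) := by
    rw [hdiff, PadicInt.norm_le_pow_iff_mem_span_pow]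
    refine Ideal.sum_mem _ fun i _ => Ideal.mul_mem_right _ _ ?_
    rw [Ideal.mem_span_singleton]
    obtain ⟨c, hc⟩ := hab i
    exact ⟨c, by rw [hc]; push_cast; ring⟩
  refine hle.trans_lt ?_
  rw [hkn, Nat.cast_add, neg_add, zpow_add₀ hp0.ne']
  exact mul_lt_mul_of_pos_right hbj (zpow_pos hp0 _)

/-- For `n` nonzero elements of a field, at least `n / k` of their `k`-th powers are distinct. -/
theorem card_le_mul_card_image_pow {F : Type*} [Field F] [DecidableEq F] {k : ℕ} (hk : k ≠ 0)
    (t : Finset F) : t.card ≤ k * (t.image (· ^ k)).card := by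
  refine Finset.card_le_mul_card_image t k fun b _ => ?_
  calc _ ≤ (Polynomial.nthRoots k b).toFinset.card := by
        refine Finset.card_le_card fun x hx => ?_
        simpa [Polynomial.mem_nthRoots (Nat.pos_of_ne_zero hk)] using (Finset.mem_filter.1 hx).2
    _ ≤ _ := (Multiset.toFinset_card_le _).trans (Polynomial.card_nthRoots k b)

/-- A second moment estimate: over a large finite field, `m x ^ k + y ^ k` represents every nonzero
element with `x, y` nonzero. -/
theorem exists_mul_pow_add_pow_eq {F : Type*} [Field F] [Fintype F] {k : ℕ} (hk : k ≠ 0)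
    (hF : 4 * k ^ 4 + 1 < Fintype.card F) {m t : F} (hm : m ≠ 0) (ht : t ≠ 0) :
    ∃ x y : F, x ≠ 0 ∧ y ≠ 0 ∧ m * x ^ k + y ^ k = t := by
  classical
  by_contra! hcon
  set U : Finset F := Finset.univ.erase 0 with hU
  set n := U.card with hn
  have hFn : Fintype.card F = n + 1 := by
    rw [hn, hU, Finset.card_erase_of_mem (Finset.mem_univ _), Finset.card_univ]
    have := Fintype.card_pos (α := F)
    omega
  have hUm : ∀ x, x ∈ U ↔ x ≠ 0 := by simp [hU]
  let val : F × F × F → F × F := fun q => (q.1, q.1 * q.2.1 ^ k + q.2.2 ^ k)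
  let T : Finset (F × F × F) := U ×ˢ U ×ˢ U
  let D : Finset (F × F) := U ×ˢ Finset.univ
  let Z : Finset (F × F) := D.filter fun d => ∀ q ∈ T, val q ≠ d
  let N : F × F → ℕ := fun d => (T.filter fun q => val q = d).card
  -- the number of missed values
  have hZ : n ^ 2 ≤ k ^ 2 * Z.card := by
    have h1 := card_le_mul_card_image_pow hk U
    have h2 : (U.image (· ^ k) ×ˢ U.image (· ^ k)).card ≤ Z.card := by
      refine Finset.card_le_card_of_injOn (fun h => (m * h.1, t * h.2)) ?_ ?_
      · rintro ⟨h₁, h₂⟩ hh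
        simp only [Finset.coe_product, Finset.coe_image, Set.mem_prod, Set.mem_image,
          Finset.mem_coe, hUm] at hh
        obtain ⟨⟨u, hu, rfl⟩, w, hw, rfl⟩ := hh
        simp only [Z, D, T, val, Finset.coe_filter, Finset.mem_product, Set.mem_ofPred_eq, hUm,
          Finset.mem_univ, and_true]
        refine ⟨mul_ne_zero hm (pow_ne_zero _ hu), ?_⟩
        rintro ⟨m', x, y⟩ ⟨-, hx, hy⟩ heq
        simp only [Prod.mk.injEq] at heq hx hy
        obtain ⟨rfl, heq⟩ := heq
        refine hcon (u * x / w) (y / w) (div_ne_zero (mul_ne_zero hu hx) hw) (div_ne_zero hy hw) ?_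
        rw [div_pow, div_pow, mul_pow, ← mul_left_inj' (pow_ne_zero k hw), ← heq]
        field_simp
      · rintro ⟨h₁, h₂⟩ - ⟨h₃, h₄⟩ - heq
        simp only [Prod.mk.injEq] at heq
        exact Prod.ext (mul_left_cancel₀ hm heq.1) (mul_left_cancel₀ ht heq.2)
    rw [Finset.card_product] at h2
    calc n ^ 2 = n * n := sq n
      _ ≤ (k * (U.image (· ^ k)).card) * (k * (U.image (· ^ k)).card) := Nat.mul_le_mul h1 h1
      _ = k ^ 2 * ((U.image (· ^ k)).card * (U.image (· ^ k)).card) := by ring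
      _ ≤ _ := Nat.mul_le_mul_left _ h2
  have hsum : ∑ d ∈ D \ Z, N d = n ^ 3 := by
    rw [← Finset.card_eq_sum_card_fiberwise]
    · simp only [T, Finset.card_product, ← hn]
      ring
    · intro q hq
      have hq' := Finset.mem_coe.1 hq
      simp only [T, Finset.mem_product] at hq'
      simp only [Finset.coe_sdiff, Set.mem_sdiff, Finset.mem_coe]
      refine ⟨by simp [D, val, hq'.1], fun hz => ?_⟩
      exact (Finset.mem_filter.1 hz).2 q hq rfl
  have hsq : ∑ d ∈ D \ Z, N d ^ 2 ≤ n ^ 4 + k ^ 2 * n ^ 3 := by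
    let E : Finset (F × F) := (U ×ˢ U).filter fun e => e.1 ^ k = e.2 ^ k
    have hE : E.card ≤ k * n := by
      refine Finset.card_le_mul_card_image_of_maps_to (f := Prod.fst) (s := E) (t := U)
        (fun e he => ?_) k fun b _ => ?_
      · exact (Finset.mem_product.1 (Finset.mem_filter.1 he).1).1
      · calc _ ≤ (Polynomial.nthRoots k (b ^ k)).toFinset.card := by
              refine Finset.card_le_card_of_injOn Prod.snd ?_ ?_
              · intro e he
                have he' := Finset.mem_filter.1 (Finset.mem_coe.1 he)
                have := (Finset.mem_filter.1 he'.1).2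
                simpa [Polynomial.mem_nthRoots (Nat.pos_of_ne_zero hk), ← he'.2] using this.symm
              · intro e he e' he' h
                have h1 := (Finset.mem_filter.1 (Finset.mem_coe.1 he)).2
                have h2 := (Finset.mem_filter.1 (Finset.mem_coe.1 he')).2
                exact Prod.ext (h1.trans h2.symm) h
          _ ≤ _ := (Multiset.toFinset_card_le _).trans (Polynomial.card_nthRoots k _)
    let W : Finset ((F × F × F) × (F × F × F)) := (T ×ˢ T).filter fun w => val w.1 = val w.2
    have hNW : ∑ d ∈ D \ Z, N d ^ 2 ≤ W.card := by
      calc _ = ∑ d ∈ D \ Z, (W.filter fun w => val w.1 = d).card := by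
            refine Finset.sum_congr rfl fun d _ => ?_
            rw [sq, ← Finset.card_product]
            congr 1
            ext ⟨q, q'⟩
            simp only [W, Finset.mem_product, Finset.mem_filter]
            constructor
            · rintro ⟨⟨h1, h2⟩, h3, h4⟩
              exact ⟨⟨⟨h1, h3⟩, h2.trans h4.symm⟩, h2⟩
            · rintro ⟨⟨⟨h1, h2⟩, h3⟩, h4⟩
              exact ⟨⟨h1, h4⟩, h2, h3 ▸ h4⟩
        _ ≤ _ := by
            rw [← Finset.card_biUnion]
            · exact Finset.card_le_card (Finset.biUnion_subset.2 fun d _ =>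
                Finset.filter_subset _ _)
            · intro d _ d' _ hdd
              exact Finset.disjoint_filter.2 fun w _ h1 h2 => hdd (h1.symm.trans h2)
    refine hNW.trans ?_
    rw [← Finset.card_filter_add_card_filter_not (fun w => w.1.2.1 ^ k = w.2.2.1 ^ k), add_comm]
    refine Nat.add_le_add ?_ ?_
    · calc _ ≤ (U ×ˢ U ×ˢ U ×ˢ U).card := by
            refine Finset.card_le_card_of_injOn
              (fun w => (w.1.2.1, w.1.2.2, w.2.2.1, w.2.2.2)) ?_ ?_
            · rintro ⟨⟨m₁, x, y⟩, m₂, x', y'⟩ hw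
              simp only [W, T, Finset.coe_filter, Finset.mem_filter, Finset.mem_product,
                Set.mem_ofPred_eq] at hw
              simp only [Finset.mem_coe, Finset.mem_product]
              tauto
            · rintro ⟨⟨m₁, x, y⟩, m₂, x', y'⟩ hw ⟨⟨m₃, z, v⟩, m₄, z', v'⟩ hw' h
              simp only [W, T, val, Finset.coe_filter, Finset.mem_filter, Finset.mem_product,
                Set.mem_ofPred_eq, Prod.mk.injEq] at hw hw' h ⊢
              obtain ⟨rfl, rfl, rfl, rfl⟩ := h
              obtain ⟨⟨-, rfl, h1⟩, h2⟩ := hw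
              obtain ⟨⟨-, rfl, h3⟩, -⟩ := hw'
              have : m₁ = m₃ := by
                have h4 : (m₁ - m₃) * (x ^ k - x' ^ k) = 0 := by linear_combination h1 - h3
                rcases mul_eq_zero.1 h4 with h5 | h5
                · exact sub_eq_zero.1 h5
                · exact absurd (sub_eq_zero.1 h5) h2
              simp [this]
        _ = n ^ 4 := by
            simp only [Finset.card_product, ← hn]
            ring
    · calc _ ≤ (U ×ˢ E ×ˢ E).card := by
            refine Finset.card_le_card_of_injOn
              (fun w => (w.1.1, (w.1.2.1, w.2.2.1), (w.1.2.2, w.2.2.2))) ?_ ?_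
            · rintro ⟨⟨m₁, x, y⟩, m₂, x', y'⟩ hw
              simp only [W, T, val, Finset.coe_filter, Finset.mem_filter, Finset.mem_product,
                Set.mem_ofPred_eq, Prod.mk.injEq] at hw
              simp only [E, Finset.mem_coe, Finset.mem_product, Finset.mem_filter]
              obtain ⟨⟨⟨⟨a1, a2, a3⟩, b1, b2, b3⟩, rfl, h1⟩, h2⟩ := hw
              rw [h2, add_right_inj] at h1
              tauto
            · rintro ⟨⟨m₁, x, y⟩, m₂, x', y'⟩ hw ⟨⟨m₃, z, v⟩, m₄, z', v'⟩ hw' h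
              simp only [W, T, val, Finset.coe_filter, Finset.mem_filter, Finset.mem_product,
                Set.mem_ofPred_eq, Prod.mk.injEq] at hw hw' h ⊢
              obtain ⟨rfl, ⟨rfl, rfl⟩, rfl, rfl⟩ := h
              obtain ⟨⟨-, rfl, -⟩, -⟩ := hw
              obtain ⟨⟨-, rfl, -⟩, -⟩ := hw'
              simp
        _ ≤ n * ((k * n) * (k * n)) := by
            rw [Finset.card_product, Finset.card_product]
            exact Nat.mul_le_mul le_rfl (Nat.mul_le_mul hE hE)
        _ = _ := by ring
  have hcard : (D \ Z).card + Z.card = n * (n + 1) := by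
    rw [Finset.card_sdiff_add_card_eq_card (Finset.filter_subset _ _), Finset.card_product,
      Finset.card_univ, hFn]
  have hCS := sq_sum_le_card_mul_sum_sq (s := D \ Z) (f := N)
  rw [hsum] at hCS
  have hn4 : 4 * k ^ 4 < n := by omega
  have hk1 : 1 ≤ k ^ 2 := Nat.one_le_pow _ _ (Nat.pos_of_ne_zero hk)
  generalize (D \ Z).card = S at *
  generalize Z.card = z at *
  have h1 : (n ^ 3) ^ 2 ≤ S * (n ^ 4 + k ^ 2 * n ^ 3) := by
    simp only [Nat.cast_id] at hCS
    exact hCS.trans (Nat.mul_le_mul_left _ hsq)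
  have h2 : n ^ 3 ≤ S * (n + k ^ 2) := by
    have hn0 : 0 < n ^ 3 := pow_pos (by omega) 3
    refine Nat.le_of_mul_le_mul_right ?_ hn0
    calc n ^ 3 * n ^ 3 = (n ^ 3) ^ 2 := by ring
      _ ≤ _ := h1
      _ = _ := by ring
  have hS : k ^ 2 * S + n ^ 2 ≤ k ^ 2 * (n * (n + 1)) := by
    rw [← hcard, mul_add]
    omega
  have h3 : k ^ 2 * n ^ 3 + n ^ 2 * (n + k ^ 2) ≤ k ^ 2 * (n * (n + 1)) * (n + k ^ 2) := by
    calc _ ≤ k ^ 2 * (S * (n + k ^ 2)) + n ^ 2 * (n + k ^ 2) := by gcongr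
      _ = (k ^ 2 * S + n ^ 2) * (n + k ^ 2) := by ring
      _ ≤ _ := Nat.mul_le_mul_right _ hS
  have hk4 : 4 * (k ^ 2) ^ 2 < n := by rwa [← pow_mul]
  generalize k ^ 2 = K at *
  have h4 : n ^ 2 ≤ K * n + K ^ 2 * n + K ^ 2 := by
    refine Nat.le_of_mul_le_mul_right (c := n) ?_ (by omega)
    nlinarith [h3]
  nlinarith [Nat.mul_le_mul hk1 hk1]

/-- For large `p`, three coefficients prime to `p` suffice for solubility in `p`-adic units. -/
theorem solZpUnit_of_not_dvd {k s p : ℕ} [hp : Fact p.Prime] (hk : k ≠ 0) (hkp : 4 * k ^ 4 + 1 < p)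
    {a : Fin s → ℤ} {i j l : Fin s} (hij : i ≠ j) (hil : i ≠ l) (hjl : j ≠ l)
    (hi : ¬ (p : ℤ) ∣ a i) (hj : ¬ (p : ℤ) ∣ a j) (hl : ¬ (p : ℤ) ∣ a l) : solZpUnit k p a := by
  have hk4 : k ≤ k ^ 4 := Nat.le_self_pow (by norm_num) k
  have hk1 : 1 ≤ k := Nat.pos_of_ne_zero hk
  rw [← ZMod.intCast_zmod_eq_zero_iff_dvd] at hi hj hl
  set R : Finset (Fin s) := ((Finset.univ.erase i).erase j).erase l with hR
  obtain ⟨z, hz0, hz⟩ : ∃ z : ZMod p, z ≠ 0 ∧ ∑ r ∈ R, (a r : ZMod p) + a l * z ^ k ≠ 0 := by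
    by_contra! hcon
    have hone : ∀ z : ZMod p, z ≠ 0 → z ^ k = 1 := by
      intro z hz
      have h1 := hcon z hz
      have h2 := hcon 1 one_ne_zero
      rw [one_pow] at h2
      refine mul_left_cancel₀ hl ?_
      linear_combination h1 - h2
    have h3 : (Finset.univ.erase (0 : ZMod p)).card ≤ k := by
      calc _ ≤ (Polynomial.nthRoots k (1 : ZMod p)).toFinset.card := by
            refine Finset.card_le_card fun x hx => ?_
            simpa [Polynomial.mem_nthRoots hk1] using hone x (Finset.ne_of_mem_erase hx)
        _ ≤ _ := (Multiset.toFinset_card_le _).trans (Polynomial.card_nthRoots k _)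
    rw [Finset.card_erase_of_mem (Finset.mem_univ _), Finset.card_univ, ZMod.card] at h3
    omega
  set c := ∑ r ∈ R, (a r : ZMod p) + a l * z ^ k with hc
  obtain ⟨x, y, hx, hy, hxy⟩ := exists_mul_pow_add_pow_eq (F := ZMod p) hk
    (by rwa [ZMod.card]) (div_ne_zero hi hj) (div_ne_zero (neg_ne_zero.2 hz) hj)
  let X : Fin s → ZMod p := fun r => if r = i then x else if r = j then y else if r = l then z else 1
  have hX0 : ∀ r, X r ≠ 0 := by
    intro r
    simp only [X]
    split_ifs <;> simp_all
  have hXsum : ∑ r, (a r : ZMod p) * X r ^ k = 0 := by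
    rw [← Finset.add_sum_erase _ _ (Finset.mem_univ i),
      ← Finset.add_sum_erase _ _ (Finset.mem_erase.2 ⟨hij.symm, Finset.mem_univ j⟩),
      ← Finset.add_sum_erase _ _ (Finset.mem_erase.2 ⟨hjl.symm, Finset.mem_erase.2
        ⟨hil.symm, Finset.mem_univ l⟩⟩), ← hR]
    have hrest : ∑ r ∈ R, (a r : ZMod p) * X r ^ k = ∑ r ∈ R, (a r : ZMod p) := by
      refine Finset.sum_congr rfl fun r hr => ?_
      simp only [hR, Finset.mem_erase] at hr
      simp [X, hr.1, hr.2.1, hr.2.2.1]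
    have hXi : X i = x := by simp [X]
    have hXj : X j = y := by simp [X, hij.symm]
    have hXl : X l = z := by simp [X, hil.symm, hjl.symm]
    rw [hrest, hXi, hXj, hXl]
    field_simp at hxy
    linear_combination hxy + hc
  have hval : ∀ r, ¬ (p : ℤ) ∣ ((X r).val : ℤ) := by
    intro r
    rw [← ZMod.intCast_zmod_eq_zero_iff_dvd]
    simpa using hX0 r
  have hnorm : ∀ n : ℤ, ¬ (p : ℤ) ∣ n → ‖(n : ℤ_[p])‖ = 1 := by
    intro n hn
    rw [← PadicInt.norm_int_lt_one_iff_dvd, not_lt] at hn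
    exact le_antisymm (PadicInt.norm_le_one _) hn
  refine solZpUnit_of_norm_lt hk (x := fun r => (((X r).val : ℤ) : ℤ_[p]))
    (fun r => PadicInt.isUnit_iff.2 (hnorm _ (hval r))) j ?_
  have hkn : ‖(k : ℤ_[p])‖ = 1 := by
    have := hnorm k (by
      intro h
      have := Nat.le_of_dvd hk1 (Int.natCast_dvd_natCast.1 h)
      omega)
    simpa using this
  rw [hnorm (a j) (by rwa [← ZMod.intCast_zmod_eq_zero_iff_dvd]), hkn]
  have hdvd : (p : ℤ) ∣ ∑ r, a r * ((X r).val : ℤ) ^ k := by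
    rw [← ZMod.intCast_zmod_eq_zero_iff_dvd]
    simpa using hXsum
  have := (PadicInt.norm_int_lt_one_iff_dvd _).2 hdvd
  simpa using this

/-- The real condition: the coefficients do not all have the same sign. -/
theorem solRplus_iff {k s : ℕ} (hk : k ≠ 0) (hs : 0 < s) {a : Fin s → ℤ} (ha : ∀ j, a j ≠ 0) :
    solRplus k a ↔ (¬ ∀ j, 0 < a j) ∧ ¬ ∀ j, a j < 0 := by
  have : Nonempty (Fin s) := ⟨⟨0, hs⟩⟩
  constructor
  · rintro ⟨x, hx, hsum⟩
    refine ⟨fun h => ?_, fun h => ?_⟩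
    · refine (Finset.sum_pos (fun j _ => ?_) Finset.univ_nonempty).ne' hsum
      exact mul_pos (by exact_mod_cast h j) (pow_pos (hx j) k)
    · refine (Finset.sum_neg (fun j _ => ?_) Finset.univ_nonempty).ne hsum
      exact mul_neg_of_neg_of_pos (by exact_mod_cast h j) (pow_pos (hx j) k)
  · rintro ⟨h1, h2⟩
    push Not at h1 h2
    obtain ⟨i, hi⟩ := h1
    obtain ⟨j, hj⟩ := h2
    set P : ℝ := ∑ r ∈ Finset.univ.filter (fun r => 0 < a r), (a r : ℝ) with hP
    set Q : ℝ := ∑ r ∈ Finset.univ.filter (fun r => ¬ 0 < a r), -(a r : ℝ) with hQ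
    have hPpos : 0 < P := by
      refine Finset.sum_pos (fun r hr => ?_) ⟨j, ?_⟩
      · exact_mod_cast (Finset.mem_filter.1 hr).2
      · simpa using lt_of_le_of_ne hj (ha j).symm
    have hQpos : 0 < Q := by
      refine Finset.sum_pos (fun r hr => ?_) ⟨i, ?_⟩
      · have h3 := (Finset.mem_filter.1 hr).2
        have : a r < 0 := lt_of_le_of_ne (not_lt.1 h3) (ha r)
        simpa using this
      · simpa using hi
    refine ⟨fun r => if 0 < a r then Q ^ (k⁻¹ : ℝ) else P ^ (k⁻¹ : ℝ), fun r => ?_, ?_⟩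
    · dsimp only
      split_ifs
      · exact Real.rpow_pos_of_pos hQpos _
      · exact Real.rpow_pos_of_pos hPpos _
    · rw [← Finset.sum_filter_add_sum_filter_not _ (fun r => 0 < a r)]
      have e1 : ∑ r ∈ Finset.univ.filter (fun r => 0 < a r),
          (a r : ℝ) * (if 0 < a r then Q ^ (k⁻¹ : ℝ) else P ^ (k⁻¹ : ℝ)) ^ k = P * Q := by
        rw [hP, Finset.sum_mul]
        refine Finset.sum_congr rfl fun r hr => ?_
        rw [if_pos (Finset.mem_filter.1 hr).2, Real.rpow_inv_natCast_pow hQpos.le hk]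
      have e2 : ∑ r ∈ Finset.univ.filter (fun r => ¬ 0 < a r),
          (a r : ℝ) * (if 0 < a r then Q ^ (k⁻¹ : ℝ) else P ^ (k⁻¹ : ℝ)) ^ k = -(Q * P) := by
        rw [hQ, Finset.sum_mul, ← Finset.sum_neg_distrib]
        refine Finset.sum_congr rfl fun r hr => ?_
        rw [if_neg (Finset.mem_filter.1 hr).2, Real.rpow_inv_natCast_pow hPpos.le hk]
        ring
      rw [e1, e2]
      ring

/-- A finite set of integers that is distributed among residue classes like an interval of
length `L`. -/
structure Equidistributed (I : Finset ℤ) (L : ℝ) : Prop where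
  nonneg : 0 ≤ L
  count : ∀ (M : ℕ) [NeZero M] (r : ZMod M),
    |((I.filter fun x : ℤ => (x : ZMod M) = r).card : ℝ) - L / M| ≤ 4
  count_dvd : ∀ M : ℕ, 0 < M → ((I.filter fun x : ℤ => (M : ℤ) ∣ x).card : ℝ) ≤ L / M

theorem Equidistributed.card_le {I : Finset ℤ} {L : ℝ} (hI : Equidistributed I L) :
    (I.card : ℝ) ≤ L := by
  simpa using hI.count_dvd 1 one_pos

theorem abs_prod_sub_pow_le {ι : Type*} (t : Finset ι) {c : ι → ℝ} {x d : ℝ} (hx : 0 ≤ x)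
    (hc : ∀ i, 0 ≤ c i) (hcx : ∀ i, |c i - x| ≤ d) :
    |∏ i ∈ t, c i - x ^ t.card| ≤ (x + d) ^ t.card - x ^ t.card := by
  induction t using Finset.cons_induction with
  | empty => simp
  | cons j t hj ih =>
    rw [Finset.prod_cons, Finset.card_cons]
    have hd : 0 ≤ d := (abs_nonneg _).trans (hcx j)
    have hprod : |∏ i ∈ t, c i| ≤ (x + d) ^ t.card := by
      rw [Finset.abs_prod, ← Finset.prod_const]
      refine Finset.prod_le_prod (fun i _ => abs_nonneg _) fun i _ => ?_
      rw [abs_of_nonneg (hc i)]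
      linarith [(abs_le.1 (hcx i)).2]
    calc |c j * ∏ i ∈ t, c i - x ^ (t.card + 1)|
        = |(c j - x) * ∏ i ∈ t, c i + x * (∏ i ∈ t, c i - x ^ t.card)| := by ring_nf
      _ ≤ |c j - x| * |∏ i ∈ t, c i| + x * |∏ i ∈ t, c i - x ^ t.card| := by
          refine (abs_add_le _ _).trans ?_
          rw [abs_mul, abs_mul, abs_of_nonneg hx]
      _ ≤ d * (x + d) ^ t.card + x * ((x + d) ^ t.card - x ^ t.card) := by
          gcongr
          exact hcx j
      _ = _ := by ring

theorem Equidistributed.card_residues {I : Finset ℤ} {L : ℝ} (hI : Equidistributed I L) {s M : ℕ}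
    [NeZero M] (R : Finset (Fin s → ZMod M)) :
    |(((Fintype.piFinset fun _ : Fin s => I).filter
        fun a => (fun j => (a j : ZMod M)) ∈ R).card : ℝ) - R.card / (M : ℝ) ^ s * L ^ s| ≤
      (L + 4 * M) ^ s - L ^ s := by
  have hM : (0 : ℝ) < M := by exact_mod_cast Nat.pos_of_neZero M
  have hcard : (((Fintype.piFinset fun _ : Fin s => I).filter
        fun a => (fun j => (a j : ZMod M)) ∈ R).card : ℝ) =
      ∑ r ∈ R, ∏ j, ((I.filter fun x : ℤ => (x : ZMod M) = r j).card : ℝ) := by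
    rw [Finset.card_eq_sum_card_fiberwise (f := fun a j => (a j : ZMod M)) (t := R)]
    · push_cast
      refine Finset.sum_congr rfl fun r hr => ?_
      rw [← Nat.cast_prod, ← Fintype.card_piFinset]
      congr 2
      ext a
      simp only [Finset.mem_filter, Fintype.mem_piFinset, funext_iff]
      constructor
      · rintro ⟨⟨h1, -⟩, h2⟩ j
        exact ⟨h1 j, h2 j⟩
      · intro h
        refine ⟨⟨fun j => (h j).1, ?_⟩, fun j => (h j).2⟩
        rwa [show (fun j => (a j : ZMod M)) = r from funext fun j => (h j).2]
    · intro a ha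
      exact (Finset.mem_filter.1 (Finset.mem_coe.1 ha)).2
  have hR : (R.card : ℝ) ≤ (M : ℝ) ^ s := by
    have := Finset.card_le_univ R
    rw [Fintype.card_fun, ZMod.card, Fintype.card_fin] at this
    exact_mod_cast this
  have hterm : ∀ r : Fin s → ZMod M,
      |∏ j, ((I.filter fun x : ℤ => (x : ZMod M) = r j).card : ℝ) - (L / M) ^ s| ≤
        (L / M + 4) ^ s - (L / M) ^ s := by
    intro r
    have := abs_prod_sub_pow_le (Finset.univ : Finset (Fin s))
      (c := fun j => ((I.filter fun x : ℤ => (x : ZMod M) = r j).card : ℝ))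
      (div_nonneg hI.nonneg hM.le) (fun _ => Nat.cast_nonneg _) (fun j => hI.count M (r j))
    simpa using this
  have hnn : 0 ≤ (L / M + 4) ^ s - (L / M) ^ s := (abs_nonneg _).trans (hterm 0)
  rw [hcard]
  calc _ = |∑ r ∈ R, (∏ j, ((I.filter fun x : ℤ => (x : ZMod M) = r j).card : ℝ) - (L / M) ^ s)| := by
        rw [Finset.sum_sub_distrib, Finset.sum_const, nsmul_eq_mul, div_pow]
        ring_nf
    _ ≤ ∑ r ∈ R, ((L / M + 4) ^ s - (L / M) ^ s) :=
        (Finset.abs_sum_le_sum_abs _ _).trans (Finset.sum_le_sum fun r _ => hterm r)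
    _ = R.card * ((L / M + 4) ^ s - (L / M) ^ s) := by rw [Finset.sum_const, nsmul_eq_mul]
    _ ≤ (M : ℝ) ^ s * ((L / M + 4) ^ s - (L / M) ^ s) := by gcongr
    _ = _ := by
        rw [mul_sub, ← mul_pow, ← mul_pow]
        congr 2 <;> field_simp

theorem abs_max_floor_sub_le {u v : ℝ} (huv : u ≤ v) {N : ℕ}
    (hN : (N : ℤ) = max (⌊v⌋ - ⌊u⌋) 0) : |(N : ℝ) - (v - u)| ≤ 1 := by
  have h0 : ⌊u⌋ ≤ ⌊v⌋ := Int.floor_mono huv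
  rw [max_eq_left (by omega)] at hN
  have hN' : (N : ℝ) = (⌊v⌋ : ℝ) - ⌊u⌋ := by exact_mod_cast hN
  rw [hN', abs_le]
  constructor <;> linarith [Int.floor_le u, Int.lt_floor_add_one u, Int.floor_le v,
    Int.lt_floor_add_one v]

theorem abs_card_Ioc_residue_sub_le {A : ℝ} (hA : 0 ≤ A) {M : ℕ} [NeZero M] (r : ZMod M) :
    |(((Finset.Ioc 0 ⌊A⌋).filter fun x : ℤ => (x : ZMod M) = r).card : ℝ) - A / M| ≤ 2 := by
  have hMpos : 0 < M := Nat.pos_of_neZero M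
  have hM1 : (1 : ℝ) ≤ M := by exact_mod_cast hMpos
  have hM : (0 : ℝ) < M := by exact_mod_cast hMpos
  have hN : (0 : ℤ) ≤ ⌊A⌋ := Int.floor_nonneg.2 hA
  have hset : ((Finset.Ioc 0 ⌊A⌋).filter fun x : ℤ => (x : ZMod M) = r) =
      (Finset.Ioc 0 ⌊A⌋).filter fun x : ℤ => x ≡ (r.val : ℤ) [ZMOD M] := by
    refine Finset.filter_congr fun x _ => ?_
    rw [← ZMod.intCast_eq_intCast_iff]
    simp
  have h1 : |(((Finset.Ioc 0 ⌊A⌋).filter fun x : ℤ => (x : ZMod M) = r).card : ℝ) -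
      ((((⌊A⌋ : ℤ) - (r.val : ℤ) : ℝ) / (M : ℝ)) - ((0 - (r.val : ℤ) : ℝ) / (M : ℝ)))| ≤ 1 := by
    refine abs_max_floor_sub_le ?_ ?_
    · gcongr
      exact_mod_cast hN
    · rw [hset]
      have := Int.Ioc_filter_modEq_card 0 ⌊A⌋ (r := M) (by exact_mod_cast hMpos) (r.val : ℤ)
      rw [← Rat.floor_cast (α := ℝ), ← Rat.floor_cast (α := ℝ)] at this
      push_cast at this ⊢
      exact this
  have h2 : ((((⌊A⌋ : ℤ) - (r.val : ℤ) : ℝ) / (M : ℝ)) - ((0 - (r.val : ℤ) : ℝ) / (M : ℝ))) =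
      (⌊A⌋ : ℝ) / M := by
    rw [← sub_div]
    congr 1
    ring
  have h3 : |(⌊A⌋ : ℝ) / M - A / M| ≤ 1 := by
    rw [← sub_div, abs_div, abs_of_pos hM, div_le_one hM]
    refine le_trans ?_ hM1
    rw [abs_le]
    constructor <;> linarith [Int.floor_le A, Int.lt_floor_add_one A]
  rw [h2] at h1
  calc _ ≤ _ := abs_sub_le _ ((⌊A⌋ : ℝ) / M) _
    _ ≤ 2 := by linarith

theorem card_Ioc_dvd_le {A : ℝ} (hA : 0 ≤ A) {M : ℕ} (hM : 0 < M) :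
    (((Finset.Ioc 0 ⌊A⌋).filter fun x : ℤ => (M : ℤ) ∣ x).card : ℝ) ≤ A / M := by
  have hM' : (0 : ℝ) < M := by exact_mod_cast hM
  have hN : (0 : ℤ) ≤ ⌊A⌋ := Int.floor_nonneg.2 hA
  have h := Int.Ioc_filter_dvd_card 0 ⌊A⌋ (r := M) (by exact_mod_cast hM)
  rw [← Rat.floor_cast (α := ℝ), ← Rat.floor_cast (α := ℝ)] at h
  push_cast at h
  have h0 : (0 : ℤ) ≤ ⌊(⌊A⌋ : ℝ) / M⌋ := Int.floor_nonneg.2 (div_nonneg (by exact_mod_cast hN) hM'.le)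
  rw [zero_div, Int.floor_zero, sub_zero, max_eq_left h0] at h
  have h' : (((Finset.Ioc 0 ⌊A⌋).filter fun x : ℤ => (M : ℤ) ∣ x).card : ℝ) =
      (⌊(⌊A⌋ : ℝ) / M⌋ : ℝ) := by exact_mod_cast h
  rw [h']
  refine (Int.floor_le _).trans ?_
  gcongr
  exact Int.floor_le A

theorem card_filter_map_neg (I : Finset ℤ) (P : ℤ → Prop) [DecidablePred P] :
    ((I.map (Equiv.neg ℤ).toEmbedding).filter P).card = (I.filter fun x => P (-x)).card := by
  rw [Finset.filter_map, Finset.card_map]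
  rfl

theorem equidistributed_pos {A : ℝ} (hA : 0 ≤ A) : Equidistributed (Finset.Ioc 0 ⌊A⌋) A where
  nonneg := hA
  count M _ r := (abs_card_Ioc_residue_sub_le hA r).trans (by norm_num)
  count_dvd M hM := card_Ioc_dvd_le hA hM

theorem abs_card_neg_residue_sub_le {A : ℝ} (hA : 0 ≤ A) {M : ℕ} [NeZero M] (r : ZMod M) :
    |((((Finset.Ioc 0 ⌊A⌋).map (Equiv.neg ℤ).toEmbedding).filter
      fun x : ℤ => (x : ZMod M) = r).card : ℝ) - A / M| ≤ 2 := by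
  rw [card_filter_map_neg]
  convert abs_card_Ioc_residue_sub_le hA (-r) using 6
  simp [neg_eq_iff_eq_neg]

theorem card_neg_dvd_le {A : ℝ} (hA : 0 ≤ A) {M : ℕ} (hM : 0 < M) :
    ((((Finset.Ioc 0 ⌊A⌋).map (Equiv.neg ℤ).toEmbedding).filter
      fun x : ℤ => (M : ℤ) ∣ x).card : ℝ) ≤ A / M := by
  rw [card_filter_map_neg]
  simpa using card_Ioc_dvd_le hA hM

theorem equidistributed_neg {A : ℝ} (hA : 0 ≤ A) :
    Equidistributed ((Finset.Ioc 0 ⌊A⌋).map (Equiv.neg ℤ).toEmbedding) A where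
  nonneg := hA
  count M _ r := (abs_card_neg_residue_sub_le hA r).trans (by norm_num)
  count_dvd M hM := card_neg_dvd_le hA hM

/-- The nonzero integers of absolute value at most `A`. -/
def nonzeroBox (A : ℝ) : Finset ℤ :=
  Finset.Ioc 0 ⌊A⌋ ∪ (Finset.Ioc 0 ⌊A⌋).map (Equiv.neg ℤ).toEmbedding

theorem mem_map_neg {I : Finset ℤ} {x : ℤ} :
    x ∈ I.map (Equiv.neg ℤ).toEmbedding ↔ -x ∈ I := by
  simp only [Finset.mem_map, Equiv.coe_toEmbedding, Equiv.neg_apply]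
  exact ⟨by rintro ⟨y, hy, rfl⟩; simpa using hy, fun h => ⟨-x, h, by simp⟩⟩

theorem mem_nonzeroBox {A : ℝ} {x : ℤ} : x ∈ nonzeroBox A ↔ x ≠ 0 ∧ (x.natAbs : ℝ) ≤ A := by
  have : (x.natAbs : ℝ) ≤ A ↔ (x.natAbs : ℤ) ≤ ⌊A⌋ := by
    rw [Int.le_floor]
    simp
  rw [this, nonzeroBox, Finset.mem_union, mem_map_neg, Finset.mem_Ioc, Finset.mem_Ioc]
  omega

theorem card_filter_nonzeroBox (A : ℝ) (P : ℤ → Prop) [DecidablePred P] :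
    ((nonzeroBox A).filter P).card = ((Finset.Ioc 0 ⌊A⌋).filter P).card +
      (((Finset.Ioc 0 ⌊A⌋).map (Equiv.neg ℤ).toEmbedding).filter P).card := by
  rw [nonzeroBox, Finset.filter_union, Finset.card_union_of_disjoint]
  refine Finset.disjoint_left.2 fun x hx hx' => ?_
  have h1 := (Finset.mem_Ioc.1 (Finset.mem_filter.1 hx).1).1
  have h2 := (Finset.mem_Ioc.1 (mem_map_neg.1 (Finset.mem_filter.1 hx').1)).1
  omega

theorem equidistributed_nonzeroBox {A : ℝ} (hA : 0 ≤ A) :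
    Equidistributed (nonzeroBox A) (2 * A) where
  nonneg := by linarith
  count M _ r := by
    rw [card_filter_nonzeroBox]
    have h1 := abs_le.1 (abs_card_Ioc_residue_sub_le hA r)
    have h2 := abs_le.1 (abs_card_neg_residue_sub_le hA r)
    push_cast
    rw [abs_le, mul_div_assoc]
    constructor <;> linarith
  count_dvd M hM := by
    rw [card_filter_nonzeroBox]
    have h1 := card_Ioc_dvd_le hA hM
    have h2 := card_neg_dvd_le hA hM
    push_cast
    rw [mul_div_assoc]
    linarith

/-- The predicate `Q` depends only on residues modulo `M`, and holds for a proportion `d` of them. -/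
def HasPeriodicDensity {s : ℕ} (Q : (Fin s → ℤ) → Prop) (M : ℕ) (d : ℝ) : Prop :=
  ∃ R : Finset (Fin s → ZMod M), (∀ a : Fin s → ℤ, Q a ↔ (fun j => (a j : ZMod M)) ∈ R) ∧
    (R.card : ℝ) = d * (M : ℝ) ^ s

theorem hasPeriodicDensity_true (s : ℕ) : HasPeriodicDensity (s := s) (fun _ => True) 1 1 := by
  refine ⟨Finset.univ, fun a => iff_of_true trivial (Finset.mem_univ _), ?_⟩
  rw [Finset.card_univ, Fintype.card_fun, ZMod.card]
  simp

theorem HasPeriodicDensity.and {s M N : ℕ} [NeZero M] [NeZero N] {Q Q' : (Fin s → ℤ) → Prop}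
    {d d' : ℝ} (h : HasPeriodicDensity Q M d) (h' : HasPeriodicDensity Q' N d')
    (hMN : M.Coprime N) : HasPeriodicDensity (fun a => Q a ∧ Q' a) (M * N) (d * d') := by
  obtain ⟨R, hR, hRc⟩ := h
  obtain ⟨R', hR', hRc'⟩ := h'
  let e := ZMod.chineseRemainder hMN
  let φ : (Fin s → ZMod M) × (Fin s → ZMod N) → Fin s → ZMod (M * N) :=
    fun r j => e.symm (r.1 j, r.2 j)
  have hφ : Function.Injective φ := by
    rintro ⟨r₁, r₂⟩ ⟨r₃, r₄⟩ h
    have h1 : ∀ j, (r₁ j, r₂ j) = (r₃ j, r₄ j) := fun j => e.symm.injective (congrFun h j)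
    exact Prod.ext (funext fun j => (Prod.ext_iff.1 (h1 j)).1)
      (funext fun j => (Prod.ext_iff.1 (h1 j)).2)
  refine ⟨(R ×ˢ R').map ⟨φ, hφ⟩, fun a => ?_, ?_⟩
  · have : (fun j => (a j : ZMod (M * N))) =
        (⟨φ, hφ⟩ : _ ↪ _) (fun j => (a j : ZMod M), fun j => (a j : ZMod N)) := by
      funext j
      simp only [Function.Embedding.coeFn_mk, φ]
      rw [RingEquiv.eq_symm_apply, map_intCast]
      rfl
    rw [this, Finset.mem_map', Finset.mem_product]
    exact and_congr (hR a) (hR' a)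
  · rw [Finset.card_map, Finset.card_product]
    push_cast
    rw [hRc, hRc', mul_pow]
    ring

theorem HasPeriodicDensity.forall_mem {s : ℕ} {ι : Type*} (P : Finset ι) {Q : ι → (Fin s → ℤ) → Prop}
    {M : ι → ℕ} {d : ι → ℝ} (hM : ∀ i, M i ≠ 0) (hQ : ∀ i, HasPeriodicDensity (Q i) (M i) (d i))
    (hco : ∀ i j, i ≠ j → (M i).Coprime (M j)) :
    HasPeriodicDensity (fun a => ∀ i ∈ P, Q i a) (∏ i ∈ P, M i) (∏ i ∈ P, d i) := by
  induction P using Finset.cons_induction with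
  | empty => simpa using hasPeriodicDensity_true s
  | cons i P hi ih =>
    have : NeZero (M i) := ⟨hM i⟩
    have : NeZero (∏ i ∈ P, M i) := ⟨Finset.prod_ne_zero_iff.2 fun j _ => hM j⟩
    rw [Finset.prod_cons, Finset.prod_cons]
    have := (hQ i).and ih (Nat.Coprime.prod_right fun j hj => hco i j (by rintro rfl; exact hi hj))
    simpa only [Finset.forall_mem_cons] using this

theorem HasPeriodicDensity.abs_card_sub_le {s M : ℕ} [NeZero M] {Q : (Fin s → ℤ) → Prop} {d : ℝ}
    (h : HasPeriodicDensity Q M d) {I : Finset ℤ} {L : ℝ} (hI : Equidistributed I L) :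
    |(((Fintype.piFinset fun _ : Fin s => I).filter Q).card : ℝ) - d * L ^ s| ≤
      (L + 4 * M) ^ s - L ^ s := by
  obtain ⟨R, hR, hRc⟩ := h
  have hM : (M : ℝ) ≠ 0 := by exact_mod_cast NeZero.ne M
  have := hI.card_residues R
  rw [hRc, mul_div_assoc, div_self (pow_ne_zero s hM), mul_one] at this
  convert this using 5
  exact Finset.filter_congr fun a _ => hR a

/-- Solubility of the equation in `p`-adic units. -/
def localSol (k : ℕ) {s : ℕ} (p : Nat.Primes) (a : Fin s → ℤ) : Prop :=
  @solZpUnit k s p ⟨p.2⟩ a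

/-- Solubility in `p`-adic units, visible modulo a power of `p`: not all coefficients are divisible
by `p ^ f`. -/
def resolvedSol (k : ℕ) {s : ℕ} (p : Nat.Primes) (f : ℕ) (a : Fin s → ℤ) : Prop :=
  localSol k p a ∧ ¬ ∀ i, (((p : ℕ) ^ f : ℕ) : ℤ) ∣ a i

/-- The modulus that determines `resolvedSol`. -/
def resolvingModulus (k : ℕ) (p : Nat.Primes) (f : ℕ) : ℕ :=
  (p : ℕ) ^ (f + 2 * padicValNat p k)

theorem resolvingModulus_ne_zero (k : ℕ) (p : Nat.Primes) (f : ℕ) : resolvingModulus k p f ≠ 0 :=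
  pow_ne_zero _ p.2.ne_zero

theorem resolvingModulus_coprime (k : ℕ) {p q : Nat.Primes} (hpq : p ≠ q) (f g : ℕ) :
    (resolvingModulus k p f).Coprime (resolvingModulus k q g) :=
  Nat.Coprime.pow _ _ ((Nat.coprime_primes p.2 q.2).2 fun h => hpq (Subtype.ext h))

/-- The density of `resolvedSol`. -/
def resolvedDensity (k s : ℕ) (p : Nat.Primes) (f : ℕ) : ℝ :=
  ({r : Fin s → ZMod (resolvingModulus k p f) |
    ∃ a : Fin s → ℤ, resolvedSol k p f a ∧ (fun j => (a j : ZMod _)) = r}.ncard : ℝ) /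
    (resolvingModulus k p f : ℝ) ^ s

theorem hasPeriodicDensity_resolvedSol {k : ℕ} (hk : k ≠ 0) (s : ℕ) (p : Nat.Primes) (f : ℕ) :
    HasPeriodicDensity (s := s) (resolvedSol k p f) (resolvingModulus k p f)
      (resolvedDensity k s p f) := by
  have : NeZero (resolvingModulus k p f) := ⟨resolvingModulus_ne_zero k p f⟩
  have : Fact (p : ℕ).Prime := ⟨p.2⟩
  refine ⟨Set.toFinset {r | ∃ a : Fin s → ℤ, resolvedSol k p f a ∧ (fun j => (a j : ZMod _)) = r},
    fun b => ?_, ?_⟩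
  · rw [Set.mem_toFinset]
    refine ⟨fun hb => ⟨b, hb, rfl⟩, ?_⟩
    rintro ⟨a, ⟨ha, hna⟩, hab⟩
    have hdvd : ∀ i, ((resolvingModulus k p f : ℕ) : ℤ) ∣ b i - a i := fun i =>
      (ZMod.intCast_eq_intCast_iff_dvd_sub _ _ _).1 (congrFun hab i)
    have hnb : ¬ ∀ i, (((p : ℕ) ^ f : ℕ) : ℤ) ∣ b i := by
      intro hb
      refine hna fun i => ?_
      have h1 : (((p : ℕ) ^ f : ℕ) : ℤ) ∣ b i - a i := by
        refine dvd_trans ?_ (hdvd i)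
        exact_mod_cast pow_dvd_pow _ (Nat.le_add_right _ _)
      exact (dvd_sub_right (hb i)).1 h1
    exact ⟨solZpUnit_of_dvd_sub hk hdvd hnb ha, hnb⟩
  · have : (resolvingModulus k p f : ℝ) ≠ 0 := by
      exact_mod_cast resolvingModulus_ne_zero k p f
    rw [resolvedDensity, Set.ncard_eq_toFinset_card', div_mul_cancel₀ _ (pow_ne_zero _ this)]

theorem resolvedDensity_pos (k : ℕ) {s : ℕ} (hs : 2 ≤ s) (p : Nat.Primes) :
    0 < resolvedDensity k s p 1 := by
  have : NeZero (resolvingModulus k p 1) := ⟨resolvingModulus_ne_zero k p 1⟩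
  have : 0 < (resolvingModulus k p 1 : ℝ) := by
    exact_mod_cast Nat.pos_of_ne_zero (resolvingModulus_ne_zero k p 1)
  refine div_pos ?_ (pow_pos this s)
  rw [Nat.cast_pos, Set.ncard_pos]
  let i₀ : Fin s := ⟨0, by omega⟩
  let i₁ : Fin s := ⟨1, by omega⟩
  have h01 : i₁ ≠ i₀ := by simp [i₀, i₁]
  let a : Fin s → ℤ := Function.update (fun _ => 1) i₀ (-(Finset.univ.erase i₀ : Finset (Fin s)).card)
  refine ⟨_, a, ⟨⟨fun _ => 1, fun _ => isUnit_one, ?_⟩, fun h => ?_⟩, rfl⟩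
  · have : Fact (p : ℕ).Prime := ⟨p.2⟩
    rw [← Finset.add_sum_erase _ _ (Finset.mem_univ i₀), Finset.sum_congr rfl
      (g := fun _ => (1 : ℤ_[p])) fun i hi => by
        simp [a, Function.update_of_ne (Finset.ne_of_mem_erase hi)]]
    simp [a]
  · have h1 := h i₁
    simp only [a, Function.update_of_ne h01, pow_one] at h1
    have h2 : (p : ℕ) ∣ 1 := by exact_mod_cast h1
    exact p.2.one_lt.ne' (Nat.dvd_one.1 h2)

/-- At most two coordinates of `a` are prime to `p`. -/
def AlmostDivisible {s : ℕ} (p : ℕ) (a : Fin s → ℤ) : Prop :=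
  ∃ T ∈ Finset.powersetCard 2 (Finset.univ : Finset (Fin s)), ∀ l ∉ T, (p : ℤ) ∣ a l

theorem almostDivisible_of_not_localSol {k s : ℕ} (hk : k ≠ 0) (hs : 2 ≤ s) {p : Nat.Primes}
    (hp : 4 * k ^ 4 + 1 < (p : ℕ)) {a : Fin s → ℤ} (ha : ¬ localSol k p a) :
    AlmostDivisible p a := by
  have : Fact (p : ℕ).Prime := ⟨p.2⟩
  rcases le_or_gt (Finset.univ.filter fun l => ¬ ((p : ℕ) : ℤ) ∣ a l).card 2 with h | h
  · obtain ⟨T, hT, hTc⟩ := Finset.exists_superset_card_eq h (by simpa using hs)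
    refine ⟨T, by simpa [Finset.mem_powersetCard] using hTc, fun l hl => ?_⟩
    by_contra hdl
    exact hl (hT (by simpa using hdl))
  · obtain ⟨i, hi, j, hj, l, hl, hij, hil, hjl⟩ := Finset.two_lt_card.1 h
    exact absurd (solZpUnit_of_not_dvd hk hp hij hil hjl (Finset.mem_filter.1 hi).2
      (Finset.mem_filter.1 hj).2 (Finset.mem_filter.1 hl).2) ha

theorem Equidistributed.card_almostDivisible_le {I : Finset ℤ} {L : ℝ} (hI : Equidistributed I L)
    {s : ℕ} (hs : 2 ≤ s) {p : ℕ} (hp : 0 < p) :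
    (((Fintype.piFinset fun _ : Fin s => I).filter (AlmostDivisible p)).card : ℝ) ≤
      s.choose 2 * (L ^ s * ((p : ℝ) ^ (s - 2))⁻¹) := by
  have hsub : (Fintype.piFinset fun _ : Fin s => I).filter (AlmostDivisible p) ⊆
      (Finset.powersetCard 2 (Finset.univ : Finset (Fin s))).biUnion fun T =>
        Fintype.piFinset fun l => if l ∈ T then I else I.filter fun x : ℤ => (p : ℤ) ∣ x := by
    intro a ha
    obtain ⟨ha, T, hT, hdvd⟩ := Finset.mem_filter.1 ha
    refine Finset.mem_biUnion.2 ⟨T, hT, Fintype.mem_piFinset.2 fun l => ?_⟩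
    have hal := Fintype.mem_piFinset.1 ha l
    split_ifs with hl
    · exact hal
    · exact Finset.mem_filter.2 ⟨hal, hdvd l hl⟩
  have hcard := (Finset.card_le_card hsub).trans Finset.card_biUnion_le
  have hterm : ∀ T ∈ Finset.powersetCard 2 (Finset.univ : Finset (Fin s)),
      ((Fintype.piFinset fun l => if l ∈ T then I else
        I.filter fun x : ℤ => (p : ℤ) ∣ x).card : ℝ) ≤ L ^ s * ((p : ℝ) ^ (s - 2))⁻¹ := by
    intro T hT
    have hTc := (Finset.mem_powersetCard.1 hT).2
    rw [Fintype.card_piFinset, Nat.cast_prod]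
    calc _ ≤ ∏ l : Fin s, if l ∈ T then L else L / p := by
          refine Finset.prod_le_prod (fun _ _ => Nat.cast_nonneg _) fun l _ => ?_
          split_ifs
          · exact hI.card_le
          · exact hI.count_dvd p hp
      _ = L ^ 2 * (L / p) ^ (s - 2) := by
          rw [Finset.prod_ite, Finset.prod_const, Finset.prod_const, Finset.filter_mem_eq_inter,
            Finset.univ_inter, hTc, Finset.filter_not, Finset.filter_mem_eq_inter,
            Finset.univ_inter, Finset.card_sdiff_of_subset (Finset.subset_univ T), hTc,
            Finset.card_univ, Fintype.card_fin]
      _ = _ := by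
          rw [div_pow, div_eq_mul_inv, ← mul_assoc, ← pow_add, Nat.add_sub_cancel' hs]
  calc _ ≤ ∑ T ∈ Finset.powersetCard 2 (Finset.univ : Finset (Fin s)),
        ((Fintype.piFinset fun l => if l ∈ T then I else
        I.filter fun x : ℤ => (p : ℤ) ∣ x).card : ℝ) := by exact_mod_cast hcard
    _ ≤ ∑ T ∈ Finset.powersetCard 2 (Finset.univ : Finset (Fin s)),
        L ^ s * ((p : ℝ) ^ (s - 2))⁻¹ := Finset.sum_le_sum hterm
    _ = _ := by
        rw [Finset.sum_const, Finset.card_powersetCard, Finset.card_univ, Fintype.card_fin,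
          nsmul_eq_mul]

theorem Equidistributed.le_of_almostDivisible {I : Finset ℤ} {L : ℝ} (hI : Equidistributed I L)
    {s : ℕ} (hs : 3 ≤ s) {p : ℕ} (hp : 0 < p) {a : Fin s → ℤ}
    (ha : a ∈ Fintype.piFinset fun _ : Fin s => I) (hd : AlmostDivisible p a) : (p : ℝ) ≤ L := by
  obtain ⟨T, hT, hdvd⟩ := hd
  have hTc := (Finset.mem_powersetCard.1 hT).2
  obtain ⟨l, hl⟩ : ∃ l, l ∉ T := by
    by_contra! h
    have := Finset.card_le_card (fun l _ => h l : Finset.univ ⊆ T)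
    rw [Finset.card_univ, Fintype.card_fin] at this
    omega
  have h1 := hI.count_dvd p hp
  have h2 : 0 < (I.filter fun x : ℤ => (p : ℤ) ∣ x).card :=
    Finset.card_pos.2 ⟨a l, Finset.mem_filter.2 ⟨Fintype.mem_piFinset.1 ha l, hdvd l hl⟩⟩
  have h3 : (1 : ℝ) ≤ (I.filter fun x : ℤ => (p : ℤ) ∣ x).card := by exact_mod_cast h2
  have hp' : (0 : ℝ) < p := by exact_mod_cast hp
  simpa using (le_div_iff₀ hp').1 (h3.trans h1)

theorem Equidistributed.card_forall_dvd_le {I : Finset ℤ} {L : ℝ} (hI : Equidistributed I L)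
    (s : ℕ) {q : ℕ} (hq : 0 < q) :
    (((Fintype.piFinset fun _ : Fin s => I).filter fun a => ∀ i, (q : ℤ) ∣ a i).card : ℝ) ≤
      L ^ s * ((q : ℝ) ^ s)⁻¹ := by
  have : ((Fintype.piFinset fun _ : Fin s => I).filter fun a => ∀ i, (q : ℤ) ∣ a i) =
      Fintype.piFinset fun _ : Fin s => I.filter fun x : ℤ => (q : ℤ) ∣ x := by
    ext a
    simp only [Finset.mem_filter, Fintype.mem_piFinset, forall_and]
  rw [this, Fintype.card_piFinset, Finset.prod_const, Finset.card_univ, Fintype.card_fin,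
    Nat.cast_pow, ← div_eq_mul_inv, ← div_pow]
  exact pow_le_pow_left₀ (Nat.cast_nonneg _) (hI.count_dvd q hq) s

theorem Equidistributed.card_piFinset_le {I : Finset ℤ} {L : ℝ} (hI : Equidistributed I L)
    (s : ℕ) (Q : (Fin s → ℤ) → Prop) :
    (((Fintype.piFinset fun _ : Fin s => I).filter Q).card : ℝ) ≤ L ^ s := by
  calc _ ≤ ((Fintype.piFinset fun _ : Fin s => I).card : ℝ) := by
        exact_mod_cast Finset.card_filter_le _ _
    _ ≤ _ := by
        rw [Fintype.card_piFinset, Finset.prod_const, Finset.card_univ, Fintype.card_fin,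
          Nat.cast_pow]
        exact pow_le_pow_left₀ (Nat.cast_nonneg _) hI.card_le s

/-- The proportion of tuples of nonzero integers of height at most `A` that satisfy `Q`. -/
def boxProportion {s : ℕ} (Q : (Fin s → ℤ) → Prop) (A : ℝ) : ℝ :=
  (((Fintype.piFinset fun _ : Fin s => nonzeroBox A).filter Q).card : ℝ) / (2 * A) ^ s

theorem HasPeriodicDensity.tendsto {s M : ℕ} [NeZero M] {Q : (Fin s → ℤ) → Prop} {d : ℝ}
    (h : HasPeriodicDensity Q M d) : Tendsto (boxProportion Q) atTop (nhds d) := by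
  have hlim : Tendsto (fun A : ℝ => (1 + 2 * M / A) ^ s - 1) atTop (nhds 0) := by
    have h1 : Tendsto (fun A : ℝ => 2 * M / A) atTop (nhds 0) :=
      tendsto_const_nhds.div_atTop tendsto_id
    simpa using ((h1.const_add 1).pow s).sub_const 1
  rw [tendsto_iff_dist_tendsto_zero]
  refine squeeze_zero' (Eventually.of_forall fun _ => dist_nonneg) ?_ hlim
  filter_upwards [eventually_gt_atTop 0] with A hA
  have h1 := h.abs_card_sub_le (equidistributed_nonzeroBox hA.le)
  have h2 : (0 : ℝ) < (2 * A) ^ s := by positivity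
  have h3 : (1 + 2 * M / A) * (2 * A) = 2 * A + 4 * M := by
    field_simp
    ring
  rw [Real.dist_eq, boxProportion, div_sub' h2.ne', abs_div, abs_of_pos h2, div_le_iff₀ h2,
    sub_mul, ← mul_pow, one_mul, mul_comm _ d, h3]
  exact h1

theorem boxProportion_mono {s : ℕ} {Q Q' : (Fin s → ℤ) → Prop} (h : ∀ a, Q a → Q' a) {A : ℝ}
    (hA : 0 ≤ A) : boxProportion Q A ≤ boxProportion Q' A := by
  unfold boxProportion
  gcongr
  exact h _

theorem boxProportion_le_add {s : ℕ} {Q Q' Q'' : (Fin s → ℤ) → Prop} (h : ∀ a, Q a → Q' a ∨ Q'' a)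
    {A : ℝ} (hA : 0 ≤ A) : boxProportion Q A ≤ boxProportion Q' A + boxProportion Q'' A := by
  unfold boxProportion
  rw [← add_div]
  gcongr
  rw [← Nat.cast_add, Nat.cast_le]
  refine (Finset.card_le_card ?_).trans (Finset.card_union_le _ _)
  rw [← Finset.filter_or]
  exact Finset.monotone_filter_right _ fun a _ => h a

theorem exists_localDensity {k : ℕ} (hk : k ≠ 0) {s : ℕ} (hs : 1 ≤ s) (p : Nat.Primes) :
    ∃ δ : ℝ, Tendsto (boxProportion (localSol k (s := s) p)) atTop (nhds δ) ∧
      ∀ f : ℕ, resolvedDensity k s p f ≤ δ ∧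
        δ ≤ resolvedDensity k s p f + (((p : ℝ) ^ f) ^ s)⁻¹ := by
  have hp0 : (0 : ℝ) < p := by exact_mod_cast p.2.pos
  have hlow : ∀ f A, 0 ≤ A → boxProportion (resolvedSol k (s := s) p f) A ≤
      boxProportion (localSol k (s := s) p) A := fun f A hA => boxProportion_mono (fun a h => h.1) hA
  have hup : ∀ f A, 0 < A → boxProportion (localSol k (s := s) p) A ≤
      boxProportion (resolvedSol k (s := s) p f) A + (((p : ℝ) ^ f) ^ s)⁻¹ := by
    intro f A hA
    refine (boxProportion_le_add (Q' := resolvedSol k p f)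
      (Q'' := fun a => ∀ i, (((p : ℕ) ^ f : ℕ) : ℤ) ∣ a i) (fun a ha => ?_) hA.le).trans ?_
    · by_cases h : ∀ i, (((p : ℕ) ^ f : ℕ) : ℤ) ∣ a i
      · exact Or.inr h
      · exact Or.inl ⟨ha, h⟩
    · gcongr
      have := (equidistributed_nonzeroBox hA.le).card_forall_dvd_le s (pow_pos p.2.pos f)
      rw [boxProportion, div_le_iff₀ (by positivity), mul_comm]
      push_cast at this ⊢
      convert this
  have hlim : ∀ f, Tendsto (boxProportion (resolvedSol k (s := s) p f)) atTop
      (nhds (resolvedDensity k s p f)) := by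
    intro f
    have : NeZero (resolvingModulus k p f) := ⟨resolvingModulus_ne_zero k p f⟩
    exact (hasPeriodicDensity_resolvedSol hk s p f).tendsto
  have hcauchy : CauchySeq (boxProportion (localSol k (s := s) p)) := by
    rw [Metric.cauchySeq_iff']
    intro ε hε
    obtain ⟨f, hf⟩ : ∃ f : ℕ, (((p : ℝ) ^ f) ^ s)⁻¹ < ε / 4 := by
      obtain ⟨f, hf⟩ := pow_unbounded_of_one_lt (ε / 4)⁻¹
        (one_lt_pow₀ (by exact_mod_cast p.2.one_lt : (1 : ℝ) < p) (by omega : s ≠ 0))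
      exact ⟨f, by rw [pow_right_comm]; exact inv_lt_of_inv_lt₀ (by positivity) hf⟩
    obtain ⟨N, hN⟩ := eventually_atTop.1 ((Metric.tendsto_nhds.1 (hlim f) (ε / 4)
      (by positivity)).and (eventually_gt_atTop 0))
    have key : ∀ A, N ≤ A → |boxProportion (localSol k (s := s) p) A - resolvedDensity k s p f| <
        ε / 2 := by
      intro A hA
      obtain ⟨h1, h2⟩ := hN A hA
      rw [Real.dist_eq, abs_lt] at h1
      rw [abs_lt]
      constructor <;> linarith [hlow f A h2.le, hup f A h2]
    refine ⟨N, fun A hA => ?_⟩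
    have h1 := abs_lt.1 (key A hA)
    have h2 := abs_lt.1 (key N le_rfl)
    rw [Real.dist_eq, abs_lt]
    constructor <;> linarith
  obtain ⟨δ, hδ⟩ := cauchySeq_tendsto_of_complete hcauchy
  refine ⟨δ, hδ, fun f => ⟨?_, ?_⟩⟩
  · refine le_of_tendsto_of_tendsto (hlim f) hδ ?_
    filter_upwards [eventually_ge_atTop 0] with A hA using hlow f A hA
  · refine le_of_tendsto_of_tendsto hδ ((hlim f).add_const _) ?_
    filter_upwards [eventually_gt_atTop 0] with A hA using hup f A hA

/-- The density of coefficient tuples soluble in `p`-adic units. -/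
def localDensity (k s : ℕ) (p : Nat.Primes) : ℝ :=
  limUnder atTop (boxProportion (localSol k (s := s) p))

theorem tendsto_localDensity {k : ℕ} (hk : k ≠ 0) {s : ℕ} (hs : 1 ≤ s) (p : Nat.Primes) :
    Tendsto (boxProportion (localSol k (s := s) p)) atTop (nhds (localDensity k s p)) := by
  obtain ⟨δ, hδ, -⟩ := exists_localDensity hk hs p
  exact tendsto_nhds_limUnder ⟨δ, hδ⟩

theorem resolvedDensity_le_localDensity {k : ℕ} (hk : k ≠ 0) {s : ℕ} (hs : 1 ≤ s) (p : Nat.Primes)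
    (f : ℕ) : resolvedDensity k s p f ≤ localDensity k s p := by
  obtain ⟨δ, hδ, h⟩ := exists_localDensity hk hs p
  rw [localDensity, hδ.limUnder_eq]
  exact (h f).1

theorem localDensity_le_resolvedDensity_add {k : ℕ} (hk : k ≠ 0) {s : ℕ} (hs : 1 ≤ s)
    (p : Nat.Primes) (f : ℕ) :
    localDensity k s p ≤ resolvedDensity k s p f + (((p : ℝ) ^ f) ^ s)⁻¹ := by
  obtain ⟨δ, hδ, h⟩ := exists_localDensity hk hs p
  rw [localDensity, hδ.limUnder_eq]
  exact (h f).2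

theorem localDensity_pos {k : ℕ} (hk : k ≠ 0) {s : ℕ} (hs : 2 ≤ s) (p : Nat.Primes) :
    0 < localDensity k s p :=
  (resolvedDensity_pos k hs p).trans_le (resolvedDensity_le_localDensity hk (by omega) p 1)

theorem localDensity_le_one {k : ℕ} (hk : k ≠ 0) {s : ℕ} (hs : 1 ≤ s) (p : Nat.Primes) :
    localDensity k s p ≤ 1 := by
  refine le_of_tendsto (tendsto_localDensity hk hs p) ?_
  filter_upwards [eventually_gt_atTop 0] with A hA
  rw [boxProportion, div_le_one (by positivity)]
  exact (equidistributed_nonzeroBox hA.le).card_piFinset_le s _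

theorem one_sub_localDensity_le {k : ℕ} (hk : k ≠ 0) {s : ℕ} (hs : 2 ≤ s) {p : Nat.Primes}
    (hp : 4 * k ^ 4 + 1 < (p : ℕ)) :
    1 - localDensity k s p ≤ s.choose 2 * ((p : ℝ) ^ (s - 2))⁻¹ := by
  rw [sub_le_iff_le_add']
  refine le_of_tendsto_of_tendsto (hasPeriodicDensity_true s).tendsto
    ((tendsto_localDensity hk (by omega) p).add_const _) ?_
  filter_upwards [eventually_gt_atTop 0] with A hA
  refine (boxProportion_le_add (Q' := localSol k p) (Q'' := AlmostDivisible p)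
    (fun a _ => ?_) hA.le).trans ?_
  · by_cases h : localSol k p a
    · exact Or.inl h
    · exact Or.inr (almostDivisible_of_not_localSol hk hs hp h)
  · gcongr
    have := (equidistributed_nonzeroBox hA.le).card_almostDivisible_le hs p.2.pos
    rw [boxProportion, div_le_iff₀ (by positivity)]
    linarith

/-- The primes that are at most `Y`. -/
def primesUpTo (Y : ℕ) : Finset Nat.Primes := Y.primesLE.subtype Nat.Prime

theorem mem_primesUpTo {Y : ℕ} {p : Nat.Primes} : p ∈ primesUpTo Y ↔ (p : ℕ) ≤ Y :=
  (Finset.mem_subtype.trans Nat.mem_primesLE).trans (and_iff_left p.2)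

theorem prod_primesUpTo {α : Type*} [CommMonoid α] (Y : ℕ) (f : ℕ → α) :
    ∏ p ∈ primesUpTo Y, f p = ∏ p ∈ Y.primesLE, f p :=
  Finset.prod_subtype_of_mem f fun _ hp => (Nat.mem_primesLE.1 hp).2

theorem card_primesUpTo_le (Y : ℕ) : (primesUpTo Y).card ≤ Y := by
  calc _ = ((primesUpTo Y).map ⟨fun p : Nat.Primes => (p : ℕ), Subtype.val_injective⟩).card :=
        (Finset.card_map _).symm
    _ ≤ (Finset.Ioc 0 Y).card := by
        refine Finset.card_le_card fun n hn => ?_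
        obtain ⟨p, hp, rfl⟩ := Finset.mem_map.1 hn
        exact Finset.mem_Ioc.2 ⟨p.2.pos, mem_primesUpTo.1 hp⟩
    _ = Y := by simp

theorem prod_primesUpTo_pow_padicValNat_le {k : ℕ} (hk : k ≠ 0) (Y : ℕ) :
    ∏ p ∈ Y.primesLE, p ^ padicValNat p k ≤ k := by
  refine (Finset.prod_le_prod_of_subset_of_one_le' (t := (Finset.range (max Y k + 1)).filter
    Nat.Prime) ?_ ?_).trans_eq (Nat.prod_pow_prime_padicValNat k hk _ (by omega))
  · intro p hp
    have := Nat.mem_primesLE.1 hp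
    exact Finset.mem_filter.2 ⟨Finset.mem_range.2 (by omega), this.2⟩
  · intro p hp _
    exact Nat.one_le_pow _ _ (Finset.mem_filter.1 hp).2.pos

/-- For each prime `p ≤ Y`, the exponent `Nat.log p Y + 1` is the least one with `Y < p ^ f`. -/
def jointModulus (k Y : ℕ) : ℕ :=
  ∏ p ∈ primesUpTo Y, resolvingModulus k p (Nat.log p Y + 1)

theorem jointModulus_ne_zero (k Y : ℕ) : jointModulus k Y ≠ 0 :=
  Finset.prod_ne_zero_iff.2 fun _ _ => resolvingModulus_ne_zero _ _ _

theorem jointModulus_le {k : ℕ} (hk : k ≠ 0) (Y : ℕ) :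
    (jointModulus k Y : ℝ) ≤ k ^ 2 * Real.exp ((2 * Real.log 4 + 4) * Y) := by
  have h1 : jointModulus k Y = Y.lcmUpto * primorial Y *
      (∏ p ∈ Y.primesLE, p ^ padicValNat p k) ^ 2 := by
    rw [jointModulus, show ∏ p ∈ primesUpTo Y, resolvingModulus k p (Nat.log p Y + 1) = _ from
      prod_primesUpTo Y fun p => p ^ (Nat.log p Y + 1 + 2 * padicValNat p k), Nat.lcmUpto_eq_prod_pow_log, ← Finset.prod_pow]
    change _ = _ * (∏ p ∈ Y.primesLE, p) * _
    rw [← Finset.prod_mul_distrib, ← Finset.prod_mul_distrib]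
    refine Finset.prod_congr rfl fun p _ => ?_
    rw [pow_add, pow_add, pow_one, mul_comm 2, pow_mul]
  have h2 : (Y.lcmUpto : ℝ) ≤ Real.exp ((Real.log 4 + 4) * Y) := by
    have hpos : (0 : ℝ) < Y.lcmUpto := by
      rw [Nat.lcmUpto_eq_prod_pow_log]
      exact_mod_cast Finset.prod_pos fun p hp => pow_pos (Nat.mem_primesLE.1 hp).2.pos _
    rw [← Real.log_le_iff_le_exp hpos, ← Chebyshev.psi_eq_log_lcmUpto]
    exact Chebyshev.psi_le_const_mul_self (Nat.cast_nonneg _)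
  have h3 : (primorial Y : ℝ) ≤ Real.exp (Real.log 4 * Y) := by
    rw [← Real.rpow_def_of_pos (by norm_num), Real.rpow_natCast]
    exact_mod_cast primorial_le_four_pow Y
  have h4 : ((∏ p ∈ Y.primesLE, p ^ padicValNat p k : ℕ) : ℝ) ≤ k := by
    exact_mod_cast prod_primesUpTo_pow_padicValNat_le hk Y
  rw [h1, Nat.cast_mul, Nat.cast_mul, Nat.cast_pow]
  calc _ ≤ Real.exp ((Real.log 4 + 4) * Y) * Real.exp (Real.log 4 * Y) * (k : ℝ) ^ 2 := by gcongr
    _ = _ := by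
        rw [← Real.exp_add, mul_comm]
        ring_nf

theorem sum_inv_pow_primes_le {s : ℕ} (hs : 4 ≤ s) {Y : ℕ} (hY : 0 < Y) {P : Finset Nat.Primes}
    (hP : ∀ p ∈ P, Y < (p : ℕ)) :
    ∑ p ∈ P, ((p : ℝ) ^ (s - 2))⁻¹ ≤ ((Y : ℝ) ^ (s - 3))⁻¹ := by
  have hY' : (0 : ℝ) < Y := by exact_mod_cast hY
  set N := max Y (P.sup fun p => (p : ℕ)) with hN
  calc ∑ p ∈ P, ((p : ℝ) ^ (s - 2))⁻¹ ≤ ∑ p ∈ P, ((Y : ℝ) ^ (s - 4))⁻¹ * ((p : ℝ) ^ 2)⁻¹ := by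
        refine Finset.sum_le_sum fun p hp => ?_
        rw [show s - 2 = (s - 4) + 2 by omega, pow_add, mul_inv]
        have : (Y : ℝ) ≤ p := by exact_mod_cast (hP p hp).le
        gcongr
    _ = ((Y : ℝ) ^ (s - 4))⁻¹ * ∑ n ∈ P.map ⟨fun p : Nat.Primes => (p : ℕ),
          Subtype.val_injective⟩, ((n : ℝ) ^ 2)⁻¹ := by
        rw [← Finset.mul_sum, Finset.sum_map]
        rfl
    _ ≤ ((Y : ℝ) ^ (s - 4))⁻¹ * ∑ n ∈ Finset.Ioc Y N, ((n : ℝ) ^ 2)⁻¹ := by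
        gcongr
        intro n hn
        obtain ⟨p, hp, rfl⟩ := Finset.mem_map.1 hn
        exact Finset.mem_Ioc.2 ⟨hP p hp,
          (Finset.le_sup (f := fun p : Nat.Primes => (p : ℕ)) hp).trans (le_max_right _ _)⟩
    _ ≤ ((Y : ℝ) ^ (s - 4))⁻¹ * (Y : ℝ)⁻¹ := by
        gcongr
        refine (sum_Ioc_inv_sq_le_sub hY.ne' (le_max_left _ _)).trans ?_
        simp
    _ = _ := by
        rw [← mul_inv, ← pow_succ]
        congr 3
        omega

theorem prod_le_prod_add_sum_sub {ι : Type*} (P : Finset ι) {x y : ι → ℝ} (hx : ∀ i, 0 ≤ x i)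
    (hxy : ∀ i, x i ≤ y i) (hy : ∀ i, y i ≤ 1) :
    ∏ i ∈ P, y i ≤ ∏ i ∈ P, x i + ∑ i ∈ P, (y i - x i) := by
  induction P using Finset.cons_induction with
  | empty => simp
  | cons j P hj ih =>
    rw [Finset.prod_cons, Finset.prod_cons, Finset.sum_cons]
    have h1 : ∏ i ∈ P, y i ≤ 1 := Finset.prod_le_one (fun i _ => (hx i).trans (hxy i))
      fun i _ => hy i
    have h2 : 0 ≤ ∑ i ∈ P, (y i - x i) := Finset.sum_nonneg fun i _ => sub_nonneg.2 (hxy i)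
    calc _ = (y j - x j) * ∏ i ∈ P, y i + x j * ∏ i ∈ P, y i := by ring
      _ ≤ (y j - x j) * 1 + x j * (∏ i ∈ P, x i + ∑ i ∈ P, (y i - x i)) :=
          add_le_add (mul_le_mul_of_nonneg_left h1 (sub_nonneg.2 (hxy j)))
            (mul_le_mul_of_nonneg_left ih (hx j))
      _ ≤ _ := by nlinarith [(hxy j).trans (hy j), hx j]

theorem multipliable_localDensity {k s : ℕ} (hk : k ≠ 0) (hs : 4 ≤ s) :
    Multipliable (localDensity k s) := by
  have hg : Summable fun p : Nat.Primes => (s.choose 2 : ℝ) * ((p : ℝ) ^ 2)⁻¹ := by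
    refine Summable.mul_left _ ?_
    exact (Real.summable_nat_pow_inv.2 (by norm_num : 1 < 2)).comp_injective
      (i := fun p : Nat.Primes => (p : ℕ)) Subtype.val_injective
  have hf : Summable fun p => localDensity k s p - 1 := by
    refine Summable.of_norm_bounded_eventually hg ?_
    refine Set.Finite.subset (primesUpTo (4 * k ^ 4 + 1)).finite_toSet fun p hp => ?_
    rw [Finset.mem_coe, mem_primesUpTo]
    by_contra! h
    refine hp ?_
    change ‖_‖ ≤ _
    rw [Real.norm_eq_abs, abs_sub_comm,
      abs_of_nonneg (sub_nonneg.2 (localDensity_le_one hk (by omega) p))]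
    refine (one_sub_localDensity_le hk (by omega) h).trans ?_
    have : (1 : ℝ) ≤ p := by exact_mod_cast p.2.one_le
    have : 2 ≤ s - 2 := by omega
    gcongr
  simpa using Real.multipliable_one_add_of_summable hf

theorem abs_prod_localDensity_sub_le {k s : ℕ} (hk : k ≠ 0) (hs : 4 ≤ s) {Y : ℕ}
    (hY : 4 * k ^ 4 + 1 ≤ Y) :
    |∏ p ∈ primesUpTo Y, localDensity k s p - ∏' p, localDensity k s p| ≤
      s.choose 2 * ((Y : ℝ) ^ (s - 3))⁻¹ := by
  have hlim : Tendsto (fun P : Finset Nat.Primes => ∏ p ∈ P, localDensity k s p) atTop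
      (nhds (∏' p, localDensity k s p)) := by
    have := (multipliable_localDensity hk hs).hasProd
    simpa [HasProd] using this
  refine le_of_tendsto (hlim.const_sub _).abs ?_
  filter_upwards [eventually_ge_atTop (primesUpTo Y)] with Q hQ
  have hpos : ∀ p, 0 ≤ localDensity k s p := fun p => (localDensity_pos hk (by omega) p).le
  have hone : ∀ p, localDensity k s p ≤ 1 := fun p => localDensity_le_one hk (by omega) p
  have h1 := Finset.prod_sdiff (f := localDensity k s) hQ
  have h2 : 1 ≤ ∏ p ∈ Q \ primesUpTo Y, localDensity k s p +
      s.choose 2 * ((Y : ℝ) ^ (s - 3))⁻¹ := by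
    calc (1 : ℝ) = ∏ p ∈ Q \ primesUpTo Y, 1 := by simp
      _ ≤ _ := prod_le_prod_add_sum_sub _ hpos hone fun _ => le_rfl
      _ ≤ ∏ p ∈ Q \ primesUpTo Y, localDensity k s p +
          ∑ p ∈ Q \ primesUpTo Y, s.choose 2 * ((p : ℝ) ^ (s - 2))⁻¹ := by
          gcongr with p hp
          refine one_sub_localDensity_le hk (by omega) ?_
          have := (Finset.mem_sdiff.1 hp).2
          rw [mem_primesUpTo] at this
          omega
      _ ≤ _ := by
          rw [← Finset.mul_sum]
          gcongr
          refine sum_inv_pow_primes_le hs (by omega) fun p hp => ?_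
          have := (Finset.mem_sdiff.1 hp).2
          rw [mem_primesUpTo] at this
          omega
  have h3 : 0 ≤ ∏ p ∈ primesUpTo Y, localDensity k s p := Finset.prod_nonneg fun p _ => hpos p
  have h4 : ∏ p ∈ primesUpTo Y, localDensity k s p ≤ 1 :=
    Finset.prod_le_one (fun p _ => hpos p) fun p _ => hone p
  have h5 : ∏ p ∈ Q \ primesUpTo Y, localDensity k s p ≤ 1 :=
    Finset.prod_le_one (fun p _ => hpos p) fun p _ => hone p
  rw [← h1, abs_of_nonneg (by nlinarith)]
  have h6 : 0 ≤ (s.choose 2 : ℝ) * ((Y : ℝ) ^ (s - 3))⁻¹ := by positivity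
  nlinarith

theorem sum_primesUpTo_inv_pow_le {s : ℕ} (hs : 4 ≤ s) {Y : ℕ} (hY : 0 < Y) :
    ∑ p ∈ primesUpTo Y, (((p : ℝ) ^ (Nat.log p Y + 1)) ^ s)⁻¹ ≤ ((Y : ℝ) ^ (s - 3))⁻¹ := by
  have hY' : (1 : ℝ) ≤ Y := by exact_mod_cast hY
  calc _ ≤ ∑ p ∈ primesUpTo Y, ((Y : ℝ) ^ s)⁻¹ := by
        refine Finset.sum_le_sum fun p _ => ?_
        gcongr
        exact_mod_cast (Nat.lt_pow_succ_log_self p.2.one_lt Y).le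
    _ = (primesUpTo Y).card * ((Y : ℝ) ^ s)⁻¹ := by rw [Finset.sum_const, nsmul_eq_mul]
    _ ≤ Y * ((Y : ℝ) ^ s)⁻¹ := by
        gcongr
        exact_mod_cast card_primesUpTo_le Y
    _ = ((Y : ℝ) ^ (s - 1))⁻¹ := by
        rw [← Nat.sub_add_cancel (by omega : 1 ≤ s), pow_succ, Nat.add_sub_cancel]
        field_simp
    _ ≤ _ := by
        have : s - 3 ≤ s - 1 := by omega
        gcongr

theorem hasPeriodicDensity_jointModulus {k : ℕ} (hk : k ≠ 0) (s Y : ℕ) :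
    HasPeriodicDensity (s := s)
      (fun a => ∀ p ∈ primesUpTo Y, resolvedSol k p (Nat.log p Y + 1) a) (jointModulus k Y)
      (∏ p ∈ primesUpTo Y, resolvedDensity k s p (Nat.log p Y + 1)) := by
  rw [jointModulus]
  exact HasPeriodicDensity.forall_mem (Q := fun p => resolvedSol k p (Nat.log p Y + 1))
    (M := fun p => resolvingModulus k p (Nat.log p Y + 1))
    (d := fun p => resolvedDensity k s p (Nat.log p Y + 1)) (primesUpTo Y)
    (fun p => resolvingModulus_ne_zero k p _)
    (fun p => hasPeriodicDensity_resolvedSol hk s p _)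
    fun p q hpq => resolvingModulus_coprime k hpq _ _

theorem Equidistributed.abs_card_localSol_sub_le {I : Finset ℤ} {L : ℝ} (hI : Equidistributed I L)
    {k s : ℕ} (hk : k ≠ 0) (hs : 4 ≤ s) {Y : ℕ} (hY : 4 * k ^ 4 + 1 ≤ Y) :
    |(((Fintype.piFinset fun _ : Fin s => I).filter fun a => ∀ p, localSol k p a).card : ℝ) -
        (∏' p, localDensity k s p) * L ^ s| ≤
      2 * (1 + s.choose 2) * (L ^ s * ((Y : ℝ) ^ (s - 3))⁻¹) +
        ((L + 4 * jointModulus k Y) ^ s - L ^ s) := by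
  have hL := hI.nonneg
  have hsum := sum_primesUpTo_inv_pow_le hs (by omega : 0 < Y)
  set B := Fintype.piFinset fun _ : Fin s => I with hB
  set S := B.filter fun a => ∀ p, localSol k p a with hS
  set T := B.filter fun a => ∀ p ∈ primesUpTo Y, resolvedSol k p (Nat.log p Y + 1) a with hT
  set e := ((Y : ℝ) ^ (s - 3))⁻¹ with he
  set d := ∏ p ∈ primesUpTo Y, resolvedDensity k s p (Nat.log p Y + 1) with hd
  have hST : (S.card : ℝ) ≤ T.card + L ^ s * e := by
    have hsub : S ⊆ T ∪ (primesUpTo Y).biUnion fun p =>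
        B.filter fun a => ∀ i, (((p : ℕ) ^ (Nat.log p Y + 1) : ℕ) : ℤ) ∣ a i := by
      intro a ha
      obtain ⟨haB, ha⟩ := Finset.mem_filter.1 ha
      rw [Finset.mem_union, Finset.mem_biUnion]
      by_contra! h
      refine h.1 (Finset.mem_filter.2 ⟨haB, fun p hp => ⟨ha p, fun hdvd => ?_⟩⟩)
      exact h.2 p hp (Finset.mem_filter.2 ⟨haB, hdvd⟩)
    have h1 := (Finset.card_le_card hsub).trans ((Finset.card_union_le _ _).trans
      (Nat.add_le_add_left Finset.card_biUnion_le _))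
    have h2 : (S.card : ℝ) ≤ T.card + ∑ p ∈ primesUpTo Y, ((B.filter fun a =>
        ∀ i, (((p : ℕ) ^ (Nat.log p Y + 1) : ℕ) : ℤ) ∣ a i).card : ℝ) := by exact_mod_cast h1
    refine h2.trans (add_le_add_right ?_ _)
    refine (Finset.sum_le_sum fun p _ => ?_).trans
      ((Finset.mul_sum _ _ _).symm.trans_le (mul_le_mul_of_nonneg_left hsum (by positivity)))
    have := hI.card_forall_dvd_le s (pow_pos p.2.pos (Nat.log p Y + 1))
    push_cast at this ⊢
    convert this
  have hTS : (T.card : ℝ) ≤ S.card + s.choose 2 * (L ^ s * e) := by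
    have hsub : T ⊆ S ∪ (primesUpTo ⌊L⌋₊ \ primesUpTo Y).biUnion fun p =>
        B.filter (AlmostDivisible p) := by
      intro a ha
      obtain ⟨haB, ha⟩ := Finset.mem_filter.1 ha
      rw [Finset.mem_union, Finset.mem_biUnion]
      by_contra! h
      refine h.1 (Finset.mem_filter.2 ⟨haB, fun p => ?_⟩)
      by_contra hp
      have hpY : p ∉ primesUpTo Y := fun hpY => hp (ha p hpY).1
      have hdiv := almostDivisible_of_not_localSol hk (by omega)
        (by rw [mem_primesUpTo] at hpY; omega) hp
      refine h.2 p (Finset.mem_sdiff.2 ⟨mem_primesUpTo.2 ?_, hpY⟩)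
        (Finset.mem_filter.2 ⟨haB, hdiv⟩)
      exact Nat.le_floor (hI.le_of_almostDivisible (by omega) p.2.pos haB hdiv)
    have h1 := (Finset.card_le_card hsub).trans ((Finset.card_union_le _ _).trans
      (Nat.add_le_add_left Finset.card_biUnion_le _))
    have h2 : (T.card : ℝ) ≤ S.card + ∑ p ∈ primesUpTo ⌊L⌋₊ \ primesUpTo Y,
        ((B.filter (AlmostDivisible p)).card : ℝ) := by exact_mod_cast h1
    refine h2.trans (add_le_add_right ?_ _)
    refine (Finset.sum_le_sum fun p _ => hI.card_almostDivisible_le (by omega) p.2.pos).trans ?_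
    rw [← Finset.mul_sum, ← Finset.mul_sum]
    gcongr
    refine sum_inv_pow_primes_le hs (by omega) fun p hp => ?_
    simpa [mem_primesUpTo] using (Finset.mem_sdiff.1 hp).2
  have hT_card : |(T.card : ℝ) - d * L ^ s| ≤ (L + 4 * jointModulus k Y) ^ s - L ^ s := by
    have : NeZero (jointModulus k Y) := ⟨jointModulus_ne_zero k Y⟩
    convert (hasPeriodicDensity_jointModulus hk s Y).abs_card_sub_le hI
  have hrpos : ∀ p : Nat.Primes, 0 ≤ resolvedDensity k s p (Nat.log p Y + 1) := fun p => by
    unfold resolvedDensity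
    positivity
  have hd1 : d ≤ ∏ p ∈ primesUpTo Y, localDensity k s p :=
    Finset.prod_le_prod (fun p _ => hrpos p)
      fun p _ => resolvedDensity_le_localDensity hk (by omega) p _
  have hd2 : ∏ p ∈ primesUpTo Y, localDensity k s p ≤ d + e := by
    refine (prod_le_prod_add_sum_sub _ hrpos (fun p => resolvedDensity_le_localDensity hk
      (by omega) p _) fun p => localDensity_le_one hk (by omega) p).trans ?_
    refine add_le_add_right ((Finset.sum_le_sum fun p _ => ?_).trans hsum) _
    rw [sub_le_iff_le_add']
    exact localDensity_le_resolvedDensity_add hk (by omega) p _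
  have hprod := abs_le.1 (abs_prod_localDensity_sub_le hk hs hY)
  have hLs : 0 ≤ L ^ s := by positivity
  have hmain : |d - ∏' p, localDensity k s p| * L ^ s ≤ (1 + s.choose 2) * (L ^ s * e) := by
    rw [← mul_assoc, mul_right_comm]
    refine mul_le_mul_of_nonneg_right (abs_le.2 ?_) hLs
    constructor <;> linarith [hprod.1, hprod.2]
  rw [← abs_of_nonneg hLs, ← abs_mul, abs_of_nonneg hLs, abs_le] at hmain
  rw [abs_le] at hT_card ⊢
  have he0 : 0 ≤ L ^ s * e := by positivity
  have hc0 : 0 ≤ (s.choose 2 : ℝ) * (L ^ s * e) := by positivity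
  constructor <;> linarith [hmain.1, hmain.2, hT_card.1, hT_card.2]

theorem add_pow_sub_pow_le {L A m : ℝ} (hL : 0 ≤ L) (hm : 0 ≤ m) (hLA : L ≤ 2 * A) (hmA : m ≤ A)
    (s : ℕ) : (L + 4 * m) ^ s - L ^ s ≤ 4 * s * 6 ^ (s - 1) * (m * A ^ (s - 1)) := by
  have h := (le_abs_self _).trans (abs_pow_sub_pow_le (L + 4 * m) L s)
  rw [add_sub_cancel_left, abs_of_nonneg (by positivity), abs_of_nonneg (by positivity),
    abs_of_nonneg hL, max_eq_left (by linarith)] at h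
  calc _ ≤ _ := h
    _ ≤ 4 * m * s * (6 * A) ^ (s - 1) := by
        gcongr
        linarith
    _ = _ := by
        rw [mul_pow]
        ring

theorem exists_eventually_abs_card_localSol_sub_le {k s : ℕ} (hk : k ≠ 0) (hs : 4 ≤ s) :
    ∃ K : ℝ, ∀ᶠ A : ℝ in atTop, ∀ (I : Finset ℤ) (L : ℝ), Equidistributed I L → L ≤ 2 * A →
      |(((Fintype.piFinset fun _ : Fin s => I).filter fun a => ∀ p, localSol k p a).card : ℝ) -
        (∏' p, localDensity k s p) * L ^ s| ≤ K * (A ^ s / Real.log A ^ (s - 3)) := by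
  set c := 2 * Real.log 4 + 4 with hc
  have hc0 : 0 < c := by
    have := Real.log_pos (by norm_num : (1 : ℝ) < 4)
    positivity
  refine ⟨2 * (1 + s.choose 2) * 2 ^ s * (4 * c) ^ (s - 3) + 4 * s * 6 ^ (s - 1) * k ^ 2, ?_⟩
  have hlog : ∀ᶠ A : ℝ in atTop, Real.log A ^ (s - 3) ≤ √A := by
    have h := (isLittleO_log_rpow_rpow_atTop ((s - 3 : ℕ) : ℝ)
      (by norm_num : (0 : ℝ) < 1 / 2)).bound one_pos
    filter_upwards [h, eventually_ge_atTop 1] with A hA hA1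
    rw [Real.rpow_natCast, ← Real.sqrt_eq_rpow, one_mul, Real.norm_eq_abs, Real.norm_eq_abs,
      abs_of_nonneg (Real.sqrt_nonneg A)] at hA
    exact (le_abs_self _).trans hA
  filter_upwards [hlog, eventually_gt_atTop 1, Real.tendsto_log_atTop.eventually_ge_atTop (4 * c),
    Real.tendsto_log_atTop.eventually_ge_atTop (2 * c * (4 * k ^ 4 + 1)),
    Real.tendsto_sqrt_atTop.eventually_ge_atTop ((k : ℝ) ^ 2)]
    with A hlogA hA1 hA2 hA3 hA4 I L hI hLA
  have hA0 : 0 < A := by linarith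
  have hl0 : 0 < Real.log A := Real.log_pos hA1
  have hsqrt := Real.mul_self_sqrt hA0.le
  set Y := ⌊Real.log A / (2 * c)⌋₊ with hY
  have hYk : 4 * k ^ 4 + 1 ≤ Y := by
    refine Nat.le_floor ?_
    rw [le_div_iff₀ (by positivity)]
    push_cast
    linarith
  have hYlow : Real.log A / (4 * c) ≤ Y := by
    have h1 := Nat.lt_floor_add_one (Real.log A / (2 * c))
    have h2 : 1 ≤ Real.log A / (4 * c) := (one_le_div (by positivity)).2 hA2
    have h3 : Real.log A / (2 * c) = 2 * (Real.log A / (4 * c)) := by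
      field_simp
      norm_num
    rw [← hY] at h1
    linarith
  have hM : (jointModulus k Y : ℝ) ≤ k ^ 2 * √A := by
    refine (jointModulus_le hk Y).trans ?_
    gcongr
    rw [Real.sqrt_eq_rpow, Real.rpow_def_of_pos hA0, Real.exp_le_exp]
    calc c * Y ≤ c * (Real.log A / (2 * c)) := by
          gcongr
          exact Nat.floor_le (by positivity)
      _ = Real.log A * (1 / 2) := by field_simp
  have hinv : ((Y : ℝ) ^ (s - 3))⁻¹ ≤ (4 * c) ^ (s - 3) / Real.log A ^ (s - 3) := by
    rw [← div_pow, ← inv_pow, ← inv_div]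
    gcongr
  refine (hI.abs_card_localSol_sub_le hk hs hYk).trans ?_
  rw [add_mul]
  have hL0 := hI.nonneg
  refine add_le_add ?_ ?_
  · calc _ ≤ 2 * (1 + s.choose 2) * ((2 * A) ^ s *
          ((4 * c) ^ (s - 3) / Real.log A ^ (s - 3))) := by gcongr
      _ = _ := by
          rw [mul_pow]
          ring
  · refine (add_pow_sub_pow_le hL0 (Nat.cast_nonneg _) hLA (hM.trans ?_) s).trans ?_
    · nlinarith [Real.sqrt_nonneg A]
    · rw [mul_assoc _ ((k : ℝ) ^ 2)]
      refine mul_le_mul_of_nonneg_left ?_ (by positivity)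
      calc (jointModulus k Y : ℝ) * A ^ (s - 1) ≤ k ^ 2 * √A * A ^ (s - 1) := by gcongr
        _ ≤ k ^ 2 * (A / Real.log A ^ (s - 3)) * A ^ (s - 1) := by
            gcongr
            rw [le_div_iff₀ (by positivity)]
            nlinarith [Real.sqrt_nonneg A]
        _ = _ := by
            rw [show s = s - 1 + 1 by omega, pow_succ, Nat.add_sub_cancel]
            ring

theorem hgt_le_iff {s : ℕ} {a : Fin s → ℤ} {A : ℝ} (hA : 0 ≤ A) :
    hgt a ≤ A ↔ ∀ j, ((a j).natAbs : ℝ) ≤ A := by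
  simp only [hgt, ← Nat.le_floor_iff hA, Finset.sup_le_iff, Finset.mem_univ, true_imp_iff]

theorem ncard_eq_card_filter {s : ℕ} {A : ℝ} (hA : 0 ≤ A) (Q : (Fin s → ℤ) → Prop) :
    {a : Fin s → ℤ | (∀ j, a j ≠ 0) ∧ hgt a ≤ A ∧ Q a}.ncard =
      ((Fintype.piFinset fun _ : Fin s => nonzeroBox A).filter Q).card := by
  rw [← Set.ncard_coe_finset]
  congr 1
  ext a
  simp only [Set.mem_ofPred_eq, Finset.coe_filter, Fintype.mem_piFinset, mem_nonzeroBox,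
    hgt_le_iff hA, forall_and, and_assoc]

theorem card_memC'_add {k s : ℕ} (hk : k ≠ 0) (hs : 0 < s) (A : ℝ) :
    ((Fintype.piFinset fun _ : Fin s => nonzeroBox A).filter (memC' k)).card +
      ((Fintype.piFinset fun _ : Fin s => Finset.Ioc 0 ⌊A⌋).filter
        fun a => ∀ p, localSol k p a).card +
      ((Fintype.piFinset fun _ : Fin s => (Finset.Ioc 0 ⌊A⌋).map (Equiv.neg ℤ).toEmbedding).filter
        fun a => ∀ p, localSol k p a).card =
      ((Fintype.piFinset fun _ : Fin s => nonzeroBox A).filter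
        fun a => ∀ p, localSol k p a).card := by
  have hposI : ∀ x ∈ nonzeroBox A, x ∈ Finset.Ioc 0 ⌊A⌋ ↔ 0 < x := by
    intro x hx
    simp only [nonzeroBox, Finset.mem_union, mem_map_neg, Finset.mem_Ioc] at hx ⊢
    omega
  have hnegI : ∀ x ∈ nonzeroBox A, x ∈ (Finset.Ioc 0 ⌊A⌋).map (Equiv.neg ℤ).toEmbedding ↔
      x < 0 := by
    intro x hx
    simp only [nonzeroBox, Finset.mem_union, mem_map_neg, Finset.mem_Ioc] at hx ⊢
    omega
  have hlocal : ∀ a : Fin s → ℤ, (∀ (p : ℕ) [Fact p.Prime], solZpUnit k p a) ↔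
      ∀ p, localSol k p a :=
    fun a => ⟨fun h p => @h p ⟨p.2⟩, fun h p hp => h ⟨p, hp.out⟩⟩
  set B := Fintype.piFinset fun _ : Fin s => nonzeroBox A with hB
  have hBpos : (Fintype.piFinset fun _ : Fin s => Finset.Ioc 0 ⌊A⌋).filter
      (fun a => ∀ p, localSol k p a) =
      (B.filter fun a => ∀ p, localSol k p a).filter fun a => ∀ j, 0 < a j := by
    ext a
    simp only [Finset.mem_filter, hB, Fintype.mem_piFinset]
    constructor
    · rintro ⟨h1, h2⟩
      have h3 : ∀ j, a j ∈ nonzeroBox A := fun j => Finset.mem_union_left _ (h1 j)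
      exact ⟨⟨h3, h2⟩, fun j => (hposI _ (h3 j)).1 (h1 j)⟩
    · rintro ⟨⟨h1, h2⟩, h3⟩
      exact ⟨fun j => (hposI _ (h1 j)).2 (h3 j), h2⟩
  have hBneg : (Fintype.piFinset fun _ : Fin s =>
      (Finset.Ioc 0 ⌊A⌋).map (Equiv.neg ℤ).toEmbedding).filter (fun a => ∀ p, localSol k p a) =
      (B.filter fun a => ∀ p, localSol k p a).filter fun a => ∀ j, a j < 0 := by
    ext a
    simp only [Finset.mem_filter, hB, Fintype.mem_piFinset]
    constructor
    · rintro ⟨h1, h2⟩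
      have h3 : ∀ j, a j ∈ nonzeroBox A := fun j => Finset.mem_union_right _ (h1 j)
      exact ⟨⟨h3, h2⟩, fun j => (hnegI _ (h3 j)).1 (h1 j)⟩
    · rintro ⟨⟨h1, h2⟩, h3⟩
      exact ⟨fun j => (hnegI _ (h1 j)).2 (h3 j), h2⟩
  have hBC : B.filter (memC' k) = ((B.filter fun a => ∀ p, localSol k p a).filter
      fun a => ¬ ∀ j, 0 < a j).filter fun a => ¬ ∀ j, a j < 0 := by
    ext a
    simp only [Finset.mem_filter, memC', hlocal]
    constructor
    · rintro ⟨h1, h2, h3⟩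
      have h0 : ∀ j, a j ≠ 0 := fun j => (mem_nonzeroBox.1 (Fintype.mem_piFinset.1 h1 j)).1
      exact ⟨⟨⟨h1, h3⟩, ((solRplus_iff hk hs h0).1 h2).1⟩, ((solRplus_iff hk hs h0).1 h2).2⟩
    · rintro ⟨⟨⟨h1, h3⟩, h4⟩, h5⟩
      have h0 : ∀ j, a j ≠ 0 := fun j => (mem_nonzeroBox.1 (Fintype.mem_piFinset.1 h1 j)).1
      exact ⟨h1, (solRplus_iff hk hs h0).2 ⟨h4, h5⟩, h3⟩
  have hneg' : (B.filter fun a => ∀ p, localSol k p a).filter (fun a => ∀ j, a j < 0) =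
      ((B.filter fun a => ∀ p, localSol k p a).filter
        fun a => ¬ ∀ j, 0 < a j).filter fun a => ∀ j, a j < 0 := by
    ext a
    simp only [Finset.mem_filter]
    constructor
    · rintro ⟨h1, h2⟩
      exact ⟨⟨h1, fun h3 => (h2 ⟨0, hs⟩).asymm (h3 ⟨0, hs⟩)⟩, h2⟩
    · rintro ⟨⟨h1, -⟩, h2⟩
      exact ⟨h1, h2⟩
  rw [hBpos, hBneg, hBC, hneg',
    ← Finset.card_filter_add_card_filter_not (s := B.filter fun a => ∀ p, localSol k p a)
      (fun a => ∀ j, 0 < a j),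
    ← Finset.card_filter_add_card_filter_not (s := (B.filter fun a => ∀ p, localSol k p a).filter
        fun a => ¬ ∀ j, 0 < a j) (fun a => ∀ j, a j < 0)]
  ring

theorem one_sub_two_zpow_mul {s : ℕ} (x : ℝ) :
    (1 - (2 : ℝ) ^ ((1 : ℤ) - (s : ℤ))) * (2 * x) ^ s = (2 * x) ^ s - 2 * x ^ s := by
  rw [zpow_sub₀ two_ne_zero, zpow_one, zpow_natCast, mul_pow]
  field_simp

theorem tprod_localDensity_mem_Icc {k s : ℕ} (hk : k ≠ 0) (hs : 4 ≤ s) :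
    ∏' p, localDensity k s p ∈ Set.Icc (0 : ℝ) 1 := by
  refine isClosed_Icc.mem_of_tendsto
    (multipliable_localDensity hk hs).hasProd (Eventually.of_forall fun P => ⟨?_, ?_⟩)
  · exact Finset.prod_nonneg fun p _ => (localDensity_pos hk (by omega) p).le
  · exact Finset.prod_le_one (fun p _ => (localDensity_pos hk (by omega) p).le)
      fun p _ => localDensity_le_one hk (by omega) p

theorem exists_abs_card_memC'_sub_le {k s : ℕ} (hk : k ≠ 0) (hs : 4 ≤ s) :
    ∃ K : ℝ, 0 < K ∧ ∀ A : ℝ, 3 ≤ A →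
      |(((Fintype.piFinset fun _ : Fin s => nonzeroBox A).filter (memC' k)).card : ℝ) -
        (∏' p, localDensity k s p) * ((2 * A) ^ s - 2 * A ^ s)| ≤
          K * (A ^ s / Real.log A ^ (s - 3)) := by
  obtain ⟨K, hK⟩ := exists_eventually_abs_card_localSol_sub_le hk hs
  obtain ⟨A₀, hA₀⟩ := eventually_atTop.1 hK
  have hA₀' : 0 < Real.log (max A₀ 3) :=
    Real.log_pos (lt_of_lt_of_le (by norm_num) (le_max_right _ _))
  refine ⟨max (3 * K) (2 ^ s * Real.log (max A₀ 3) ^ (s - 3)),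
    lt_max_of_lt_right (by positivity), fun A hA => ?_⟩
  have hA0 : 0 < A := by linarith
  have hlog : 0 < Real.log A := Real.log_pos (by linarith)
  rcases le_or_gt A₀ A with h | h
  · have h1 := abs_le.1 (hA₀ A h _ _ (equidistributed_nonzeroBox hA0.le) le_rfl)
    have h2 := abs_le.1 (hA₀ A h _ _ (equidistributed_pos hA0.le) (by linarith))
    have h3 := abs_le.1 (hA₀ A h _ _ (equidistributed_neg hA0.le) (by linarith))
    have h4 := congrArg (Nat.cast (R := ℝ)) (card_memC'_add hk (by omega : 0 < s) A)
    push_cast at h4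
    refine le_trans ?_ (mul_le_mul_of_nonneg_right (le_max_left _ _) (by positivity))
    rw [abs_le]
    constructor <;> linarith [h1.1, h1.2, h2.1, h2.2, h3.1, h3.2]
  · refine le_trans ?_ (mul_le_mul_of_nonneg_right (le_max_right _ _) (by positivity))
    have h1 := (equidistributed_nonzeroBox hA0.le).card_piFinset_le s (memC' k)
    have h2 := tprod_localDensity_mem_Icc hk hs
    have h3 : 2 * A ^ s ≤ (2 * A) ^ s := by
      rw [mul_pow]
      gcongr
      exact le_self_pow₀ one_le_two (by omega)
    have h4 : (0 : ℝ) < A ^ s := by positivity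
    calc _ ≤ (2 * A) ^ s := by
          rw [abs_le]
          have h5 := mul_le_mul_of_nonneg_right h2.2 (sub_nonneg.2 h3)
          have h6 := mul_nonneg h2.1 (sub_nonneg.2 h3)
          have h7 : (0 : ℝ) ≤ ((Fintype.piFinset fun _ : Fin s => nonzeroBox A).filter
            (memC' k)).card := Nat.cast_nonneg _
          constructor <;> linarith
      _ = 2 ^ s * Real.log A ^ (s - 3) * (A ^ s / Real.log A ^ (s - 3)) := by
          rw [mul_pow]
          field_simp
      _ ≤ _ := by
          gcongr
          exact h.le.trans (le_max_left _ _)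

theorem stmt5 (k s : ℕ) (hk : 2 ≤ k) (hs : 4 ≤ s) :
    ∃ δ : Nat.Primes → ℝ,
      (∀ p : Nat.Primes, 0 < δ p ∧
        Tendsto (fun A : ℝ =>
            ({a : Fin s → ℤ | (∀ j, a j ≠ 0) ∧ hgt a ≤ A ∧
                @solZpUnit k s (p : ℕ) ⟨p.2⟩ a}.ncard : ℝ) / (2 * A) ^ s)
          atTop (nhds (δ p))) ∧
      Multipliable δ ∧
      ∃ K : ℝ, 0 < K ∧ ∀ A : ℝ, 3 ≤ A →
        |({a : Fin s → ℤ | (∀ j, a j ≠ 0) ∧ hgt a ≤ A ∧ memC' k a}.ncard : ℝ)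
            - (1 - (2 : ℝ) ^ ((1 : ℤ) - (s : ℤ))) * (∏' p : Nat.Primes, δ p) * (2 * A) ^ s|
          ≤ K * A ^ s / Real.log A ^ (s - 3) := by
  have hk0 : k ≠ 0 := by omega
  refine ⟨localDensity k s, fun p => ⟨localDensity_pos hk0 (by omega) p, ?_⟩,
    multipliable_localDensity hk0 hs, ?_⟩
  · refine (tendsto_localDensity hk0 (by omega) p).congr' ?_
    filter_upwards [eventually_ge_atTop 0] with A hA
    rw [ncard_eq_card_filter hA]
    rfl
  · obtain ⟨K, hK, h⟩ := exists_abs_card_memC'_sub_le hk0 hs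
    refine ⟨K, hK, fun A hA => ?_⟩
    rw [ncard_eq_card_filter (by linarith), mul_right_comm, one_sub_two_zpow_mul,
      mul_comm _ (∏' _, _), mul_div_assoc]
    exact h A hA
end
end
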